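/- arXiv:2305.03146 — 3 statements merged into one kernel-verified Lean document; each statement's English description precedes it below -/
import Mathlib

section
/- There is an absolute constant c > 0 such that the following dichotomy holds. Let n ≥ 2 and let K ⊆ ℝⁿ be any convex set with vol(K) > 0, and let μ = E_{x ∼ N(0,I_n)|K}[x]. Then either ‖μ‖² ≥ 0.06, or E_{x ∼ N(0,I_n)|K}[‖x‖²] ≤ n − min(c·(1 − vol(K)), 0.05). -/
open MeasureTheory ProbabilityTheory Real

/-- The standard Gaussian measure `N(0, I_n)` on `ℝⁿ`. -/
noncomputable def stdGaussian (n : ℕ) : Measure (EuclideanSpace ℝ (Fin n)) :=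
  volume.withDensity fun x =>
    ENNReal.ofReal ((2 * π) ^ (-(n : ℝ) / 2) * Real.exp (-‖x‖ ^ 2 / 2))

/-- The standard Gaussian measure conditioned on the set `K`. -/
noncomputable def truncGaussian (n : ℕ) (K : Set (EuclideanSpace ℝ (Fin n))) :
    Measure (EuclideanSpace ℝ (Fin n)) :=
  (stdGaussian n K)⁻¹ • (stdGaussian n).restrict K

lemma bm_compact {A B C : Set ℝ} (hA : IsCompact A) (hB : IsCompact B)
    (nA : A.Nonempty) (nB : B.Nonempty) (h : ∀ a ∈ A, ∀ b ∈ B, (a + b) / 2 ∈ C) :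
    volume A + volume B ≤ 2 * volume C := by
  set a := sSup A
  set b := sInf B
  have ha : a ∈ A := hA.sSup_mem nA
  have hb : b ∈ B := hB.sInf_mem nB
  set D : Set ℝ := (fun x => (1/2 : ℝ) * x) ⁻¹' C
  have hD : volume D = 2 * volume C := by
    rw [Real.volume_preimage_mul_left (by norm_num)]
    congr 1
    norm_num
  set A1 : Set ℝ := (fun x => x + (-b)) ⁻¹' A
  set B1 : Set ℝ := (fun x => x + (-a)) ⁻¹' B
  have e1 : volume A1 = volume A := measure_preimage_add_right _ _ _
  have e2 : volume B1 = volume B := measure_preimage_add_right _ _ _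
  have mB1 : MeasurableSet B1 := (measurable_add_const _) hB.measurableSet
  rw [← hD, ← e1, ← e2]
  have hdis : AEDisjoint volume A1 B1 := by
    refine measure_mono_null (t := {a + b}) ?_ (by simp)
    rintro x ⟨h1, h2⟩
    have h3 : x + -b ≤ a := le_csSup hA.bddAbove h1
    have h4 : b ≤ x + -a := csInf_le hB.bddBelow h2
    simp only [Set.mem_singleton_iff]
    linarith
  rw [← measure_union₀ mB1.nullMeasurableSet hdis]
  apply measure_mono
  rintro x (hx | hx)
  · have := h _ hx b hb
    simp only [D, Set.mem_preimage]
    convert this using 1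
    ring
  · have := h a ha _ hx
    simp only [D, Set.mem_preimage]
    convert this using 1
    ring

lemma bm_one {A B C : Set ℝ} (hA : MeasurableSet A) (hB : MeasurableSet B)
    (nA : A.Nonempty) (nB : B.Nonempty) (h : ∀ a ∈ A, ∀ b ∈ B, (a + b) / 2 ∈ C) :
    volume A + volume B ≤ 2 * volume C := by
  obtain ⟨a0, ha0⟩ := nA
  obtain ⟨b0, hb0⟩ := nB
  rw [hA.measure_eq_iSup_isCompact, hB.measure_eq_iSup_isCompact]
  simp only [iSup_and']
  apply ENNReal.biSup_add_biSup_le'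
  · exact ⟨∅, Set.empty_subset _, isCompact_empty⟩
  · exact ⟨∅, Set.empty_subset _, isCompact_empty⟩
  · rintro K ⟨hK, cK⟩ L ⟨hL, cL⟩
    have := bm_compact (A := insert a0 K) (B := insert b0 L) (C := C) (cK.insert a0) (cL.insert b0)
      ⟨a0, by simp⟩ ⟨b0, by simp⟩ ?_
    · refine le_trans (add_le_add (measure_mono ?_) (measure_mono ?_)) this
      · exact Set.subset_insert _ _
      · exact Set.subset_insert _ _
    · intro a ha b hb
      apply h
      · exact Set.insert_subset ha0 hK ha
      · exact Set.insert_subset hb0 hL hb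

lemma pl_norm {f g h : ℝ → ℝ} (mf : Measurable f) (mg : Measurable g) (mh : Measurable h)
    (pf : ∀ x, 0 ≤ f x) (pg : ∀ x, 0 ≤ g x) (ph : ∀ x, 0 ≤ h x)
    (f1 : ∀ x, f x ≤ 1) (g1 : ∀ x, g x ≤ 1)
    (sf : ∀ t < 1, ∃ x, t < f x) (sg : ∀ t < 1, ∃ x, t < g x)
    (H : ∀ x y, f x * g y ≤ h ((x + y) / 2) ^ 2) :
    (∫⁻ x, ENNReal.ofReal (f x)) + (∫⁻ x, ENNReal.ofReal (g x))
      ≤ 2 * ∫⁻ x, ENNReal.ofReal (h x) := by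
  rw [lintegral_eq_lintegral_meas_lt _ (Filter.Eventually.of_forall pf) mf.aemeasurable,
    lintegral_eq_lintegral_meas_lt _ (Filter.Eventually.of_forall pg) mg.aemeasurable,
    lintegral_eq_lintegral_meas_lt _ (Filter.Eventually.of_forall ph) mh.aemeasurable]
  rw [← lintegral_const_mul' _ _ (by simp)]
  have anti : Measurable (fun t : ℝ => volume {a | t < f a}) := by
    apply Antitone.measurable
    intro s t hst
    exact measure_mono fun x hx => lt_of_le_of_lt hst hx
  rw [← lintegral_add_left anti]
  apply setLIntegral_mono' measurableSet_Ioi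
  intro t ht
  simp only [Set.mem_Ioi] at ht
  by_cases h1 : t < 1
  · apply bm_one (measurableSet_lt measurable_const mf) (measurableSet_lt measurable_const mg)
    · exact sf t h1
    · exact sg t h1
    · intro a ha b hb
      simp only [Set.mem_ofPred_eq] at *
      have := H a b
      by_contra hc
      push Not at hc
      nlinarith [ph ((a + b) / 2), mul_lt_mul'' ha hb ht.le ht.le]
  · push Not at h1
    have e1 : {a | t < f a} = ∅ := by
      ext x; simp; linarith [f1 x]
    have e2 : {a | t < g a} = ∅ := by
      ext x; simp; linarith [g1 x]
    rw [e1, e2]; simp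

lemma ennreal_amgm (x y z : ENNReal) (h : x + y ≤ 2 * z) : x * y ≤ z ^ 2 := by
  by_cases hz : z = ⊤
  · subst hz; simp
  have hx : x ≠ ⊤ := by
    rintro rfl
    simp at h
    exact (ENNReal.mul_ne_top (by simp) hz) h
  have hy : y ≠ ⊤ := by
    rintro rfl
    simp at h
    exact (ENNReal.mul_ne_top (by simp) hz) h
  lift x to NNReal using hx
  lift y to NNReal using hy
  lift z to NNReal using hz
  norm_cast at *
  have h' : (x : ℝ) + y ≤ 2 * z := by exact_mod_cast h
  have : (x : ℝ) * y ≤ z ^ 2 := by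
    nlinarith [sq_nonneg ((x : ℝ) - y), x.2, y.2, z.2, NNReal.coe_nonneg x, NNReal.coe_nonneg y]
  exact_mod_cast this

lemma pl_bdd {f g h : ℝ → ENNReal} (mf : Measurable f) (mg : Measurable g) (mh : Measurable h)
    (N M : NNReal) (f1 : ∀ x, f x ≤ N) (g1 : ∀ x, g x ≤ M)
    (H : ∀ x y, f x * g y ≤ h ((x + y) / 2) ^ 2) :
    (∫⁻ x, f x) * (∫⁻ x, g x) ≤ (∫⁻ x, h x) ^ 2 := by
  have hAt : (⨆ x, f x) ≠ ⊤ := ne_top_of_le_ne_top ENNReal.coe_ne_top (iSup_le f1)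
  have hBt : (⨆ x, g x) ≠ ⊤ := ne_top_of_le_ne_top ENNReal.coe_ne_top (iSup_le g1)
  obtain ⟨A, hA⟩ : ∃ A : NNReal, (A : ENNReal) = ⨆ x, f x := ⟨_, ENNReal.coe_toNNReal hAt⟩
  obtain ⟨B, hB⟩ : ∃ B : NNReal, (B : ENNReal) = ⨆ x, g x := ⟨_, ENNReal.coe_toNNReal hBt⟩
  have fA : ∀ x, f x ≤ A := fun x => hA ▸ le_iSup f x
  have gB : ∀ x, g x ≤ B := fun x => hB ▸ le_iSup g x
  by_cases A0 : A = 0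
  · have : ∀ x, f x = 0 := fun x => by simpa [A0] using fA x
    simp [this]
  by_cases B0 : B = 0
  · have : ∀ x, g x = 0 := fun x => by simpa [B0] using gB x
    simp [this]
  have Apos : (0:ℝ) < A := by exact_mod_cast pos_iff_ne_zero.2 A0
  have Bpos : (0:ℝ) < B := by exact_mod_cast pos_iff_ne_zero.2 B0
  set c : ℝ := √((A:ℝ) * B) with hc
  have cpos : 0 < c := Real.sqrt_pos.2 (by positivity)
  have cc : c * c = A * B := Real.mul_self_sqrt (by positivity)
  have ft : ∀ x, f x ≠ ⊤ := fun x => ne_top_of_le_ne_top ENNReal.coe_ne_top (fA x)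
  have gt : ∀ x, g x ≠ ⊤ := fun x => ne_top_of_le_ne_top ENNReal.coe_ne_top (gB x)
  set h' : ℝ → ENNReal := fun x => min (h x) (ENNReal.ofReal c)
  have ht : ∀ x, h' x ≠ ⊤ := fun x => ne_top_of_le_ne_top ENNReal.ofReal_ne_top (min_le_right _ _)
  have mh' : Measurable h' := mh.min measurable_const
  have H' : ∀ x y, f x * g y ≤ h' ((x + y) / 2) ^ 2 := by
    intro x y
    rcases le_total (h ((x + y) / 2)) (ENNReal.ofReal c) with hh | hh
    · simp only [h', min_eq_left hh]; exact H x y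
    · simp only [h', min_eq_right hh]
      rw [sq, ← ENNReal.ofReal_mul cpos.le, cc]
      refine (mul_le_mul' (fA x) (gB y)).trans ?_
      rw [ENNReal.ofReal_mul (by positivity)]; simp
  have key := pl_norm (f := fun x => (f x).toReal / A) (g := fun x => (g x).toReal / B)
    (h := fun x => (h' x).toReal / c) (mf.ennreal_toReal.div_const _)
    (mg.ennreal_toReal.div_const _) (mh'.ennreal_toReal.div_const _)
    (fun x => by positivity) (fun x => by positivity) (fun x => by positivity)
    (fun x => by
      rw [div_le_one Apos]
      simpa using ENNReal.toReal_mono ENNReal.coe_ne_top (fA x))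
    (fun x => by
      rw [div_le_one Bpos]
      simpa using ENNReal.toReal_mono ENNReal.coe_ne_top (gB x))
    (fun t ht => by
      by_contra hcon
      push Not at hcon
      have : (A : ENNReal) ≤ ENNReal.ofReal (t * A) := by
        rw [hA]
        refine iSup_le fun x => ?_
        rw [← ENNReal.ofReal_toReal (ft x)]
        exact ENNReal.ofReal_le_ofReal (by have := hcon x; rwa [div_le_iff₀ Apos] at this)
      have h2 : (A:ENNReal) = ENNReal.ofReal (A:ℝ) := by simp
      rw [h2, ENNReal.ofReal_le_ofReal_iff'] at this
      rcases this with h | h <;> nlinarith)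
    (fun t ht => by
      by_contra hcon
      push Not at hcon
      have : (B : ENNReal) ≤ ENNReal.ofReal (t * B) := by
        rw [hB]
        refine iSup_le fun x => ?_
        rw [← ENNReal.ofReal_toReal (gt x)]
        exact ENNReal.ofReal_le_ofReal (by have := hcon x; rwa [div_le_iff₀ Bpos] at this)
      have h2 : (B:ENNReal) = ENNReal.ofReal (B:ℝ) := by simp
      rw [h2, ENNReal.ofReal_le_ofReal_iff'] at this
      rcases this with h | h <;> nlinarith)
    (fun x y => by
      have := ENNReal.toReal_mono (ENNReal.pow_ne_top (ht _)) (H' x y)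
      rw [ENNReal.toReal_mul, ENNReal.toReal_pow] at this
      rw [div_pow, sq c, cc, div_mul_div_comm]
      gcongr)
  have conv : ∀ (k : ℝ → ENNReal) (_ : ∀ x, k x ≠ ⊤) (a : ℝ) (_ : 0 < a),
      ∫⁻ x, k x = ENNReal.ofReal a * ∫⁻ x, ENNReal.ofReal ((k x).toReal / a) := by
    intro k hk a ha
    rw [← lintegral_const_mul' _ _ (by simp)]
    refine lintegral_congr fun x => ?_
    rw [← ENNReal.ofReal_mul ha.le, mul_div_cancel₀ _ ha.ne', ENNReal.ofReal_toReal (hk x)]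
  have key2 := ennreal_amgm _ _ _ key
  calc (∫⁻ x, f x) * (∫⁻ x, g x)
      = (ENNReal.ofReal A * ENNReal.ofReal B) * ((∫⁻ x, ENNReal.ofReal ((f x).toReal / A)) *
          ∫⁻ x, ENNReal.ofReal ((g x).toReal / B)) := by
        rw [conv f ft A Apos, conv g gt B Bpos]; ring
    _ ≤ (ENNReal.ofReal c * ENNReal.ofReal c) * (∫⁻ x, ENNReal.ofReal ((h' x).toReal / c)) ^ 2 := by
        rw [← ENNReal.ofReal_mul Apos.le, ← ENNReal.ofReal_mul cpos.le, cc]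
        gcongr
    _ = (∫⁻ x, h' x) ^ 2 := by
        rw [conv h' ht c cpos]; ring
    _ ≤ _ := by
        gcongr
        exact min_le_left _ _

lemma pl_one {f g h : ℝ → ENNReal} (mf : Measurable f) (mg : Measurable g) (mh : Measurable h)
    (H : ∀ x y, f x * g y ≤ h ((x + y) / 2) ^ 2) :
    (∫⁻ x, f x) * (∫⁻ x, g x) ≤ (∫⁻ x, h x) ^ 2 := by
  have trunc : ∀ (k : ℝ → ENNReal) (_ : Measurable k),
      ∫⁻ x, k x = ⨆ N : ℕ, ∫⁻ x, min (k x) ((N : NNReal) : ENNReal) := by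
    intro k hk
    rw [← lintegral_iSup (fun N => hk.min measurable_const)]
    · refine lintegral_congr fun x => ?_
      have : (⨆ N : ℕ, ((N : NNReal) : ENNReal)) = ⊤ := by
        simpa using ENNReal.iSup_natCast
      have h2 := inf_iSup_eq (k x) (fun N : ℕ => ((N : NNReal) : ENNReal))
      rw [this] at h2
      simpa using h2
    · intro N M hNM x
      apply min_le_min le_rfl
      have : (N : NNReal) ≤ M := by exact_mod_cast hNM
      exact ENNReal.coe_le_coe.2 this
  rw [trunc f mf, trunc g mg]
  rw [ENNReal.iSup_mul]
  refine iSup_le fun N => ?_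
  rw [ENNReal.mul_iSup]
  refine iSup_le fun M => ?_
  apply pl_bdd (mf.min measurable_const) (mg.min measurable_const) mh N M
    (fun x => min_le_right _ _) (fun x => min_le_right _ _)
  intro x y
  exact (mul_le_mul' (min_le_left _ _) (min_le_left _ _)).trans (H x y)

lemma pl_pi (n : ℕ) : ∀ {f g h : (Fin n → ℝ) → ENNReal}, Measurable f → Measurable g →
    Measurable h → (∀ x y, f x * g y ≤ h ((1/2 : ℝ) • (x + y)) ^ 2) →
    (∫⁻ x, f x) * (∫⁻ x, g x) ≤ (∫⁻ x, h x) ^ 2 := by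
  induction n with
  | zero =>
    intro f g h mf mg mh H
    rw [Measure.volume_pi_eq_dirac]
    rw [lintegral_dirac' _ mf, lintegral_dirac' _ mg, lintegral_dirac' _ mh]
    refine (H _ _).trans (le_of_eq ?_)
    congr 2
    exact Subsingleton.elim _ _
  | succ n ih =>
    intro f g h mf mg mh H
    have e := (volume_preserving_piFinSuccAbove (fun _ : Fin (n + 1) => ℝ) 0).symm
    have conv : ∀ (k : (Fin (n+1) → ℝ) → ENNReal) (_ : Measurable k),
        ∫⁻ x, k x = ∫⁻ s : ℝ, ∫⁻ x : Fin n → ℝ, k (Fin.cons s x) := by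
      intro k hk
      rw [← e.lintegral_comp hk, Measure.volume_eq_prod,
        lintegral_prod (fun a => k ((MeasurableEquiv.piFinSuccAbove (fun _ : Fin (n + 1) => ℝ) 0).symm a))
          (hk.comp e.measurable).aemeasurable]
      refine lintegral_congr fun s => lintegral_congr fun x => ?_
      congr 1
      exact Fin.insertNth_zero' _ _
    have mc : Measurable (fun p : ℝ × (Fin n → ℝ) => (Fin.cons p.1 p.2 : Fin (n+1) → ℝ)) := by
      refine measurable_pi_iff.2 fun i => ?_
      refine Fin.cases ?_ (fun i => ?_) i
      · simpa using measurable_fst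
      · simp only [Fin.cons_succ]
        exact (measurable_pi_apply i).comp measurable_snd
    rw [conv f mf, conv g mg, conv h mh]
    have ms : ∀ (k : (Fin (n+1) → ℝ) → ENNReal) (_ : Measurable k),
        Measurable (fun s : ℝ => ∫⁻ x : Fin n → ℝ, k (Fin.cons s x)) := fun k hk =>
      Measurable.lintegral_prod_right' (f := fun p : ℝ × (Fin n → ℝ) => k (Fin.cons p.1 p.2))
        (hk.comp mc)
    refine pl_one (ms f mf) (ms g mg) (ms h mh) ?_
    intro s t
    have mcs : ∀ s : ℝ, Measurable (fun x : Fin n → ℝ => (Fin.cons s x : Fin (n+1) → ℝ)) :=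
      fun s => mc.comp measurable_prodMk_left
    refine ih (mf.comp (mcs s)) (mg.comp (mcs t)) (mh.comp (mcs _)) ?_
    intro x y
    refine (H _ _).trans (le_of_eq ?_)
    congr 2
    ext i
    refine Fin.cases ?_ (fun i => ?_) i
    · simp; ring
    · simp; ring

lemma pl_euclid (n : ℕ) {f g h : EuclideanSpace ℝ (Fin n) → ENNReal} (mf : Measurable f)
    (mg : Measurable g) (mh : Measurable h)
    (H : ∀ x y, f x * g y ≤ h ((1/2 : ℝ) • (x + y)) ^ 2) :
    (∫⁻ x, f x) * (∫⁻ x, g x) ≤ (∫⁻ x, h x) ^ 2 := by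
  have e := PiLp.volume_preserving_toLp (Fin n)
  rw [← e.lintegral_comp mf, ← e.lintegral_comp mg, ← e.lintegral_comp mh]
  refine pl_pi n (mf.comp e.measurable) (mg.comp e.measurable) (mh.comp e.measurable) ?_
  intro x y
  exact H _ _

lemma dens_meas (n : ℕ) : Measurable (fun x : EuclideanSpace ℝ (Fin n) =>
    ENNReal.ofReal ((2 * π) ^ (-(n : ℝ) / 2) * Real.exp (-‖x‖ ^ 2 / 2))) := by
  fun_prop

lemma lintegral_std (n : ℕ) {w : EuclideanSpace ℝ (Fin n) → ENNReal} (mw : Measurable w) :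
    ∫⁻ x, w x ∂(stdGaussian n) = ∫⁻ x,
      ENNReal.ofReal ((2 * π) ^ (-(n : ℝ) / 2) * Real.exp (-‖x‖ ^ 2 / 2)) * w x := by
  unfold _root_.stdGaussian
  rw [lintegral_withDensity_eq_lintegral_mul _ (dens_meas n) mw]
  rfl

lemma plg (n : ℕ) {f g h : EuclideanSpace ℝ (Fin n) → ENNReal} (mf : Measurable f)
    (mg : Measurable g) (mh : Measurable h)
    (H : ∀ x y, f x * g y * ENNReal.ofReal (Real.exp (-‖x - y‖ ^ 2 / 4))
      ≤ h ((1/2 : ℝ) • (x + y)) ^ 2) :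
    (∫⁻ x, f x ∂(stdGaussian n)) * (∫⁻ x, g x ∂(stdGaussian n))
      ≤ (∫⁻ x, h x ∂(stdGaussian n)) ^ 2 := by
  rw [lintegral_std n mf, lintegral_std n mg, lintegral_std n mh]
  refine pl_euclid n ((dens_meas n).mul mf) ((dens_meas n).mul mg) ((dens_meas n).mul mh) ?_
  intro x y
  set C : ℝ := (2 * π) ^ (-(n : ℝ) / 2)
  have hC : 0 ≤ C := by positivity
  have key : (C * Real.exp (-‖x‖ ^ 2 / 2)) * (C * Real.exp (-‖y‖ ^ 2 / 2)) =
      (C * Real.exp (-‖(1/2 : ℝ) • (x + y)‖ ^ 2 / 2)) ^ 2 * Real.exp (-‖x - y‖ ^ 2 / 4) := by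
    have h1 := parallelogram_law_with_norm ℝ x y
    have h2 : ‖(1/2 : ℝ) • (x + y)‖ = ‖x + y‖ / 2 := by
      rw [norm_smul]; norm_num; ring
    have : Real.exp (-‖x‖ ^ 2 / 2) * Real.exp (-‖y‖ ^ 2 / 2) =
      Real.exp (-‖(1/2 : ℝ) • (x + y)‖ ^ 2 / 2) ^ 2 * Real.exp (-‖x - y‖ ^ 2 / 4) := by
      rw [← Real.exp_add, ← Real.exp_nat_mul, ← Real.exp_add, h2]
      congr 1
      push_cast
      nlinarith
    calc _ = C ^ 2 * (Real.exp (-‖x‖ ^ 2 / 2) * Real.exp (-‖y‖ ^ 2 / 2)) := by ring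
      _ = _ := by rw [this]; ring
  have key' := congrArg ENNReal.ofReal key
  rw [ENNReal.ofReal_mul (p := C * Real.exp (-‖x‖ ^ 2 / 2)) (by positivity),
    ENNReal.ofReal_mul (p := (C * Real.exp (-‖(1/2 : ℝ) • (x + y)‖ ^ 2 / 2)) ^ 2) (by positivity),
    ENNReal.ofReal_pow (by positivity)] at key'
  calc _ = (ENNReal.ofReal (C * Real.exp (-‖x‖ ^ 2 / 2)) *
        ENNReal.ofReal (C * Real.exp (-‖y‖ ^ 2 / 2))) * (f x * g y) := by ring
    _ = ENNReal.ofReal (C * Real.exp (-‖(1/2 : ℝ) • (x + y)‖ ^ 2 / 2)) ^ 2 *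
        (f x * g y * ENNReal.ofReal (Real.exp (-‖x - y‖ ^ 2 / 4))) := by rw [key']; ring
    _ ≤ ENNReal.ofReal (C * Real.exp (-‖(1/2 : ℝ) • (x + y)‖ ^ 2 / 2)) ^ 2 *
        h ((1/2 : ℝ) • (x + y)) ^ 2 := by gcongr; exact H x y
    _ = _ := by simp only [mul_pow, Pi.mul_apply]

lemma integrable_gauss (n : ℕ) {b : ℝ} (hb : 0 < b) :
    Integrable (fun x : EuclideanSpace ℝ (Fin n) => Real.exp (-b * ‖x‖ ^ 2)) := by
  have := (GaussianFourier.integrable_cexp_neg_mul_sq_norm_add (V := EuclideanSpace ℝ (Fin n))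
    (b := b) (by simpa using hb) 0 0).norm
  refine this.congr (Filter.Eventually.of_forall fun x => ?_)
  simp [Complex.norm_exp]
  norm_cast
  exact Or.inl rfl

lemma dens_eq (n : ℕ) (x : EuclideanSpace ℝ (Fin n)) :
    Real.exp (-‖x‖ ^ 2 / 2) = Real.exp (-(1/2) * ‖x‖ ^ 2) := by
  congr 1; ring

instance std_prob (n : ℕ) : IsProbabilityMeasure (_root_.stdGaussian n) := by
  constructor
  unfold _root_.stdGaussian
  rw [withDensity_apply _ MeasurableSet.univ, Measure.restrict_univ]
  rw [← ofReal_integral_eq_lintegral_ofReal]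
  · rw [integral_const_mul]
    simp_rw [dens_eq]
    rw [GaussianFourier.integral_rexp_neg_mul_sq_norm (by norm_num)]
    rw [finrank_euclideanSpace_fin, show π / (1/2) = 2 * π by ring, ← Real.rpow_add (by positivity)]
    rw [neg_div, neg_add_cancel]
    simp
  · simp_rw [dens_eq]
    exact (integrable_gauss n (by norm_num)).const_mul _
  · exact Filter.Eventually.of_forall fun x => by positivity

lemma integral_std (n : ℕ) (f : EuclideanSpace ℝ (Fin n) → ℝ) (s : Set (EuclideanSpace ℝ (Fin n)))
    (hs : MeasurableSet s) :
    ∫ x in s, f x ∂(stdGaussian n) =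
      ∫ x in s, ((2 * π) ^ (-(n : ℝ) / 2) * Real.exp (-‖x‖ ^ 2 / 2)) * f x := by
  unfold _root_.stdGaussian
  rw [setIntegral_withDensity_eq_setIntegral_toReal_smul (dens_meas n)
    (Filter.Eventually.of_forall fun x => by simp) _ hs]
  refine integral_congr_ae (Filter.Eventually.of_forall fun x => ?_)
  simp only [smul_eq_mul]
  rw [ENNReal.toReal_ofReal (by positivity)]

lemma integrable_exp4 (n : ℕ) :
    Integrable (fun x : EuclideanSpace ℝ (Fin n) => Real.exp (‖x‖ ^ 2 / 4)) (stdGaussian n) := by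
  unfold _root_.stdGaussian
  rw [integrable_withDensity_iff_integrable_smul' (dens_meas n)
    (Filter.Eventually.of_forall fun x => by simp)]
  refine ((integrable_gauss n (b := 1/4) (by norm_num)).const_mul
    ((2 * π) ^ (-(n : ℝ) / 2))).congr (Filter.Eventually.of_forall fun x => ?_)
  simp only [smul_eq_mul]
  rw [ENNReal.toReal_ofReal (by positivity), mul_assoc, ← Real.exp_add]
  congr 2; ring

lemma trunc_prob {n : ℕ} {K : Set (EuclideanSpace ℝ (Fin n))}
    (hv : 0 < (stdGaussian n K).toReal) : IsProbabilityMeasure (truncGaussian n K) :=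
  ProbabilityTheory.cond_isProbabilityMeasure (μ := _root_.stdGaussian n) (s := K)
    (fun h => by simp [h] at hv)

lemma trunc_integrable {n : ℕ} {K : Set (EuclideanSpace ℝ (Fin n))}
    (hv : 0 < (stdGaussian n K).toReal) {f : EuclideanSpace ℝ (Fin n) → ℝ} (mf : Measurable f)
    (C : ℝ) (hf : ∀ x, |f x| ≤ C * Real.exp (‖x‖ ^ 2 / 4)) :
    Integrable f (truncGaussian n K) := by
  have h1 : Integrable f (stdGaussian n) :=
    ((integrable_exp4 n).const_mul C).mono' mf.aestronglyMeasurable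
      (Filter.Eventually.of_forall hf)
  unfold truncGaussian
  refine (h1.restrict).smul_measure ?_
  simp only [ne_eq, ENNReal.inv_eq_top]
  intro h; simp [h] at hv

lemma trunc_ae {n : ℕ} {K : Set (EuclideanSpace ℝ (Fin n))} (mK : MeasurableSet K) :
    ∀ᵐ x ∂(truncGaussian n K), x ∈ K := by
  unfold truncGaussian
  exact Measure.ae_smul_measure (ae_restrict_mem mK) _

lemma plp {n : ℕ} {K : Set (EuclideanSpace ℝ (Fin n))} (cK : Convex ℝ K) (mK : MeasurableSet K)
    {f g h : EuclideanSpace ℝ (Fin n) → ENNReal} (mf : Measurable f)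
    (mg : Measurable g) (mh : Measurable h)
    (H : ∀ x ∈ K, ∀ y ∈ K, f x * g y * ENNReal.ofReal (Real.exp (-‖x - y‖ ^ 2 / 4))
      ≤ h ((1/2 : ℝ) • (x + y)) ^ 2) :
    (∫⁻ x, f x ∂(truncGaussian n K)) * (∫⁻ x, g x ∂(truncGaussian n K))
      ≤ (∫⁻ x, h x ∂(truncGaussian n K)) ^ 2 := by
  have conv : ∀ k : EuclideanSpace ℝ (Fin n) → ENNReal, ∫⁻ x, k x ∂(truncGaussian n K) =
      (stdGaussian n K)⁻¹ * ∫⁻ x, K.indicator k x ∂(stdGaussian n) := by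
    intro k
    unfold truncGaussian
    rw [lintegral_smul_measure, lintegral_indicator mK]
    rfl
  rw [conv, conv, conv]
  have := plg n (mf.indicator mK) (mg.indicator mK) (mh.indicator mK) ?_
  · calc _ = ((stdGaussian n K)⁻¹) ^ 2 * ((∫⁻ x, K.indicator f x ∂(stdGaussian n)) *
          ∫⁻ x, K.indicator g x ∂(stdGaussian n)) := by ring
      _ ≤ ((stdGaussian n K)⁻¹) ^ 2 * (∫⁻ x, K.indicator h x ∂(stdGaussian n)) ^ 2 := by gcongr
      _ = _ := by ring
  · intro x y
    by_cases hx : x ∈ K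
    · by_cases hy : y ∈ K
      · have hm : (1/2 : ℝ) • (x + y) ∈ K := by
          rw [smul_add]
          exact cK hx hy (by norm_num) (by norm_num) (by norm_num)
        rw [Set.indicator_of_mem hx, Set.indicator_of_mem hy, Set.indicator_of_mem hm]
        exact H x hx y hy
      · simp [Set.indicator_of_notMem hy]
    · simp [Set.indicator_of_notMem hx]

lemma two_add_sq_le (z : ℝ) : 2 + z ^ 2 ≤ Real.exp z + Real.exp (-z) := by
  have h1 : Real.exp z + Real.exp (-z) = 2 + 4 * Real.sinh (z / 2) ^ 2 := by
    have a : Real.exp z = Real.exp (z / 2) ^ 2 := by rw [← Real.exp_nat_mul]; congr 1; push_cast; ring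
    have b : Real.exp (-z) = Real.exp (-(z / 2)) ^ 2 := by
      rw [← Real.exp_nat_mul]; congr 1; push_cast; ring
    have c : Real.exp (z / 2) * Real.exp (-(z / 2)) = 1 := by rw [← Real.exp_add]; simp
    rw [Real.sinh_eq, a, b]
    nlinarith
  have h2 : (z / 2) ^ 2 ≤ Real.sinh (z / 2) ^ 2 := by
    rw [sq_le_sq]
    rcases le_total 0 (z / 2) with h | h
    · rw [abs_of_nonneg h]
      exact (Real.self_le_sinh_iff.2 h).trans (le_abs_self _)
    · rw [abs_of_nonpos h]
      have := Real.sinh_le_self_iff.2 h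
      exact (neg_le_neg this).trans (neg_le_abs _)
  nlinarith

lemma trunc_int_poly {n : ℕ} {K : Set (EuclideanSpace ℝ (Fin n))}
    (hv : 0 < (stdGaussian n K).toReal) {f : EuclideanSpace ℝ (Fin n) → ℝ} (mf : Measurable f)
    (a b : ℝ) (ha : 0 ≤ a) (hb : 0 ≤ b) (hf : ∀ x, |f x| ≤ a + b * ‖x‖ ^ 4) :
    Integrable f (truncGaussian n K) := by
  refine trunc_integrable hv mf (a + 32 * b) fun x => (hf x).trans ?_
  have h1 : 1 ≤ Real.exp (‖x‖ ^ 2 / 4) := Real.one_le_exp (by positivity)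
  have h2 := Real.quadratic_le_exp_of_nonneg (x := ‖x‖ ^ 2 / 4) (by positivity)
  have h3 : ‖x‖ ^ 4 ≤ 32 * Real.exp (‖x‖ ^ 2 / 4) := by nlinarith [sq_nonneg ‖x‖]
  nlinarith

lemma sq_le_quart (t : ℝ) : t ^ 2 ≤ 1 + t ^ 4 := by nlinarith [sq_nonneg (t ^ 2 - 1), sq_nonneg (t^2)]

lemma int_lin {n : ℕ} {K : Set (EuclideanSpace ℝ (Fin n))}
    (hv : 0 < (stdGaussian n K).toReal) (e : EuclideanSpace ℝ (Fin n)) (he : ‖e‖ = 1) (m : ℝ) :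
    Integrable (fun x => inner ℝ e x - m) (truncGaussian n K) := by
  refine trunc_int_poly hv (by fun_prop) (2 + |m|) 1 (by positivity) (by positivity) fun x => ?_
  have h1 : |inner ℝ e x| ≤ ‖x‖ := by simpa [he] using abs_real_inner_le_norm e x
  have h2 := abs_sub (inner ℝ e x) m
  nlinarith [sq_le_quart ‖x‖, sq_nonneg (‖x‖ - 1)]

lemma int_lin_sq {n : ℕ} {K : Set (EuclideanSpace ℝ (Fin n))}
    (hv : 0 < (stdGaussian n K).toReal) (e : EuclideanSpace ℝ (Fin n)) (he : ‖e‖ = 1) (m : ℝ) :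
    Integrable (fun x => (inner ℝ e x - m) ^ 2) (truncGaussian n K) := by
  refine trunc_int_poly hv (by fun_prop) (2 + 2 * m ^ 2) 2 (by positivity) (by positivity)
    fun x => ?_
  have h1 : |inner ℝ e x| ≤ ‖x‖ := by simpa [he] using abs_real_inner_le_norm e x
  have h3 : (inner ℝ e x) ^ 2 ≤ ‖x‖ ^ 2 := by rw [← sq_abs]; gcongr
  rw [abs_of_nonneg (sq_nonneg _)]
  nlinarith [sq_le_quart ‖x‖, sq_nonneg (inner ℝ e x + m)]

lemma var_le_one {n : ℕ} {K : Set (EuclideanSpace ℝ (Fin n))} (cK : Convex ℝ K)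
    (mK : MeasurableSet K) (hv : 0 < (stdGaussian n K).toReal)
    (e : EuclideanSpace ℝ (Fin n)) (he : ‖e‖ = 1) (m : ℝ)
    (hm : ∫ x, (inner ℝ e x - m) ∂(truncGaussian n K) = 0) :
    ∫ x, (inner ℝ e x - m) ^ 2 ∂(truncGaussian n K) ≤ 1 := by
  have hP := trunc_prob hv
  set P := truncGaussian n K
  set V := ∫ x, (inner ℝ e x - m) ^ 2 ∂P
  have hin : ∀ x, |inner ℝ e x| ≤ ‖x‖ := fun x => by simpa [he] using abs_real_inner_le_norm e x
  have iexp : ∀ s : ℝ, Integrable (fun x => Real.exp (s * (inner ℝ e x - m))) P := by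
    intro s
    refine trunc_integrable hv (by fun_prop) (Real.exp (s ^ 2 - s * m)) fun x => ?_
    rw [abs_of_pos (Real.exp_pos _), ← Real.exp_add]
    apply Real.exp_le_exp.2
    have : s * inner ℝ e x ≤ |s| * ‖x‖ := by
      calc _ ≤ |s * inner ℝ e x| := le_abs_self _
        _ = |s| * |inner ℝ e x| := abs_mul _ _
        _ ≤ _ := by gcongr; exact hin x
    nlinarith [sq_nonneg (|s| - ‖x‖ / 2), sq_abs s]
  have ge1 : ∀ s : ℝ, 1 ≤ ∫ x, Real.exp (s * (inner ℝ e x - m)) ∂P := by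
    intro s
    have : ∫ x, (1 + s * (inner ℝ e x - m)) ∂P = 1 := by
      rw [integral_add (integrable_const _) ((int_lin hv e he m).const_mul s), integral_const_mul, hm]
      simp
    rw [← this]
    refine integral_mono ((integrable_const _).add ((int_lin hv e he m).const_mul s)) (iexp s) ?_
    intro x
    have := Real.add_one_le_exp (s * (inner ℝ e x - m))
    simp only
    linarith
  have main : ∀ s : ℝ, 1 + s ^ 2 * V ≤ Real.exp (s ^ 2) := by
    intro s
    have hsum : 2 + s ^ 2 * V ≤ (∫ x, Real.exp (s * (inner ℝ e x - m)) ∂P) +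
        ∫ x, Real.exp (-s * (inner ℝ e x - m)) ∂P := by
      have : ∫ x, (2 + s ^ 2 * (inner ℝ e x - m) ^ 2) ∂P = 2 + s ^ 2 * V := by
        rw [integral_add (integrable_const _) ((int_lin_sq hv e he m).const_mul _),
          integral_const_mul]
        simp [V]
        exact Or.inl rfl
      rw [← this, ← integral_add (iexp s) (iexp (-s))]
      refine integral_mono ((integrable_const _).add ((int_lin_sq hv e he m).const_mul _))
        ((iexp s).add (iexp (-s))) ?_
      intro x
      have := two_add_sq_le (s * (inner ℝ e x - m))
      simp only [Pi.add_apply]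
      rw [neg_mul]
      linarith [mul_pow s (inner ℝ e x - m) 2]
    have hprod : (∫ x, Real.exp (s * (inner ℝ e x - m)) ∂P) *
        (∫ x, Real.exp (-s * (inner ℝ e x - m)) ∂P) ≤ Real.exp (s ^ 2) := by
      have := plp cK mK (f := fun x => ENNReal.ofReal (Real.exp (s * (inner ℝ e x - m))))
        (g := fun x => ENNReal.ofReal (Real.exp (-s * (inner ℝ e x - m))))
        (h := fun _ => ENNReal.ofReal (Real.exp (s ^ 2 / 2))) (by fun_prop) (by fun_prop)
        (by fun_prop) ?_
      · change (∫⁻ x, _ ∂P) * (∫⁻ x, _ ∂P) ≤ (∫⁻ x, _ ∂P) ^ 2 at this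
        rw [← ofReal_integral_eq_lintegral_ofReal (iexp s)
            (Filter.Eventually.of_forall fun x => by positivity),
          ← ofReal_integral_eq_lintegral_ofReal (iexp (-s))
            (Filter.Eventually.of_forall fun x => by positivity),
          lintegral_const, measure_univ, mul_one,
          ← ENNReal.ofReal_mul (by linarith [ge1 s]), ← ENNReal.ofReal_pow (by positivity),
          ENNReal.ofReal_le_ofReal_iff (by positivity), ← Real.exp_nat_mul] at this
        refine this.trans (le_of_eq ?_)
        congr 1; push_cast; ring
      · intro x _ y _
        rw [← ENNReal.ofReal_mul (by positivity), ← ENNReal.ofReal_mul (by positivity),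
          ← ENNReal.ofReal_pow (by positivity)]
        apply ENNReal.ofReal_le_ofReal
        rw [← Real.exp_add, ← Real.exp_add, ← Real.exp_nat_mul]
        apply Real.exp_le_exp.2
        have h1 : inner ℝ e (x - y) = inner ℝ e x - inner ℝ e y := inner_sub_right _ _ _
        have : s * inner ℝ e (x - y) ≤ |s| * ‖x - y‖ := by
          calc _ ≤ |s * inner ℝ e (x - y)| := le_abs_self _
            _ = |s| * |inner ℝ e (x - y)| := abs_mul _ _
            _ ≤ _ := by gcongr; exact hin _
        rw [h1] at this
        push_cast
        nlinarith [sq_nonneg (|s| - ‖x - y‖ / 2), sq_abs s]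
    nlinarith [mul_nonneg (sub_nonneg.2 (ge1 s)) (sub_nonneg.2 (ge1 (-s)))]
  by_contra hc
  push Not at hc
  -- choose t = s^2 with V > exp t - 1 / t
  set t : ℝ := (V - 1) / (2 * V) with ht
  have hV : 0 < V := by linarith
  have t0 : 0 < t := by rw [ht]; apply div_pos <;> linarith
  have tV : t * V = (V - 1) / 2 := by rw [ht]; field_simp
  have t1 : t < 1 := by nlinarith
  have h1 := main (√t)
  rw [Real.sq_sqrt t0.le] at h1
  have h2 : Real.exp t * (1 - t) ≤ 1 := by
    have := Real.add_one_le_exp (-t)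
    calc Real.exp t * (1 - t) ≤ Real.exp t * Real.exp (-t) := by gcongr; linarith
      _ = 1 := by rw [← Real.exp_add]; simp
  nlinarith

lemma slab_sq {n : ℕ} {K : Set (EuclideanSpace ℝ (Fin n))} (cK : Convex ℝ K)
    (mK : MeasurableSet K) (hv : 0 < (stdGaussian n K).toReal)
    (u : EuclideanSpace ℝ (Fin n)) (hu : ‖u‖ = 1) (r : ℝ) (hK : ∀ x ∈ K, -r ≤ inner ℝ u x) :
    0 ≤ ∫ x, (inner ℝ u x - (-r)) ∂(truncGaussian n K) ∧
    ∫ x, (inner ℝ u x - (-r)) ^ 2 ∂(truncGaussian n K) ≤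
      4 * (∫ x, (inner ℝ u x - (-r)) ∂(truncGaussian n K)) ^ 2 := by
  have hP := trunc_prob hv
  have i1 := int_lin hv u hu (-r)
  have i2 := int_lin_sq hv u hu (-r)
  have hae : ∀ᵐ x ∂(truncGaussian n K), 0 ≤ inner ℝ u x - (-r) := by
    filter_upwards [trunc_ae mK] with x hx
    linarith [hK x hx]
  have h0 : 0 ≤ ∫ x, (inner ℝ u x - (-r)) ∂(truncGaussian n K) := integral_nonneg_of_ae hae
  refine ⟨h0, ?_⟩
  have := plp cK mK (f := fun x => ENNReal.ofReal ((inner ℝ u x - (-r)) ^ 2))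
    (g := fun x => 1)
    (h := fun x => ENNReal.ofReal (2 * (inner ℝ u x - (-r)))) (by fun_prop) (by fun_prop)
    (by fun_prop) ?_
  · rw [← ofReal_integral_eq_lintegral_ofReal i2
          (Filter.Eventually.of_forall fun x => by positivity),
      ← ofReal_integral_eq_lintegral_ofReal (i1.const_mul 2)
          (hae.mono fun x hx => by simp only [Pi.zero_apply]; linarith),
      lintegral_const, measure_univ, mul_one, mul_one, integral_const_mul,
      ← ENNReal.ofReal_pow (by positivity), ENNReal.ofReal_le_ofReal_iff (by positivity)] at this
    linarith [mul_pow 2 (∫ x, (inner ℝ u x - (-r)) ∂(truncGaussian n K)) 2]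
  · intro x hx y hy
    have hx' := hK x hx
    have hy' := hK y hy
    have e : inner ℝ u ((1/2 : ℝ) • (x + y)) = (inner ℝ u x + inner ℝ u y) / 2 := by
      rw [real_inner_smul_right, inner_add_right]; ring
    rw [mul_one, e, ← ENNReal.ofReal_mul (by positivity), ← ENNReal.ofReal_pow (by linarith)]
    apply ENNReal.ofReal_le_ofReal
    have h1 : Real.exp (-‖x - y‖ ^ 2 / 4) ≤ 1 := by
      apply Real.exp_le_one_iff.2
      have := sq_nonneg ‖x - y‖
      linarith
    calc (inner ℝ u x - (-r)) ^ 2 * Real.exp (-‖x - y‖ ^ 2 / 4)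
        ≤ (inner ℝ u x - (-r)) ^ 2 * 1 := by gcongr
      _ ≤ _ := by
        rw [mul_one]
        apply pow_le_pow_left₀ (by linarith)
        linarith

lemma int_id {n : ℕ} {K : Set (EuclideanSpace ℝ (Fin n))}
    (hv : 0 < (stdGaussian n K).toReal) :
    Integrable (fun x : EuclideanSpace ℝ (Fin n) => x) (truncGaussian n K) := by
  have : Integrable (fun x : EuclideanSpace ℝ (Fin n) => ‖x‖) (truncGaussian n K) := by
    refine trunc_int_poly hv (by fun_prop) 2 1 (by positivity) (by positivity) fun x => ?_
    rw [abs_of_nonneg (norm_nonneg _)]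
    nlinarith [sq_le_quart ‖x‖, sq_nonneg (‖x‖ - 1)]
  exact (integrable_norm_iff measurable_id.aestronglyMeasurable).1 this

lemma exists_onb {n : ℕ} (hn : 2 ≤ n) (u : EuclideanSpace ℝ (Fin n)) (hu : ‖u‖ = 1) :
    ∃ (b : OrthonormalBasis (Fin n) ℝ (EuclideanSpace ℝ (Fin n))) (i : Fin n), b i = u := by
  let i0 : Fin n := ⟨0, by omega⟩
  have ho : Orthonormal ℝ (({i0} : Set (Fin n)).domRestrict (fun _ : Fin n => u)) := by
    constructor
    · intro i; simpa using hu
    · intro i j hij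
      exact absurd (Subsingleton.elim i j) hij
  obtain ⟨b, hb⟩ := Orthonormal.exists_orthonormalBasis_extension_of_card_eq
    (ι := Fin n) (𝕜 := ℝ) (E := EuclideanSpace ℝ (Fin n)) (by simp) (v := fun _ => u)
    (s := {i0}) ho
  exact ⟨b, i0, hb i0 rfl⟩

lemma caseB {n : ℕ} (hn : 2 ≤ n) {K : Set (EuclideanSpace ℝ (Fin n))} (cK : Convex ℝ K)
    (mK : MeasurableSet K) (hv : 0 < (stdGaussian n K).toReal)
    (u : EuclideanSpace ℝ (Fin n)) (hu : ‖u‖ = 1) (hK : ∀ x ∈ K, -(1/5) ≤ inner ℝ u x)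
    (hμ : ‖∫ x, x ∂(truncGaussian n K)‖ ^ 2 < 0.06) :
    ∫ x, ‖x‖ ^ 2 ∂(truncGaussian n K) ≤ n - 0.3 := by
  have hP := trunc_prob hv
  obtain ⟨b, i0, hb⟩ := exists_onb hn u hu
  set M := ∫ x, x ∂(truncGaussian n K) with hM
  have hb1 : ∀ i, ‖b i‖ = 1 := fun i => b.orthonormal.1 i
  have hin : ∀ e : EuclideanSpace ℝ (Fin n), ∫ x, inner ℝ e x ∂(truncGaussian n K) = inner ℝ e M :=
    fun e => integral_inner (int_id hv) e
  have ii : ∀ e : EuclideanSpace ℝ (Fin n), ‖e‖ = 1 →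
      Integrable (fun x => inner ℝ e x) (truncGaussian n K) :=
    fun e he => by simpa using int_lin hv e he 0
  have ii2 : ∀ e : EuclideanSpace ℝ (Fin n), ‖e‖ = 1 →
      Integrable (fun x => inner ℝ e x ^ 2) (truncGaussian n K) :=
    fun e he => by simpa using int_lin_sq hv e he 0
  have hsh : ∀ e : EuclideanSpace ℝ (Fin n), ‖e‖ = 1 → ∀ m : ℝ,
      ∫ x, (inner ℝ e x - m) ∂(truncGaussian n K) = inner ℝ e M - m := by
    intro e he m
    rw [integral_sub (ii e he) (integrable_const _), hin]
    simp
  have hsh2 : ∀ e : EuclideanSpace ℝ (Fin n), ‖e‖ = 1 → ∀ m : ℝ,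
      ∫ x, (inner ℝ e x - m) ^ 2 ∂(truncGaussian n K) =
        (∫ x, inner ℝ e x ^ 2 ∂(truncGaussian n K)) - 2 * m * inner ℝ e M + m ^ 2 := by
    intro e he m
    have : ∀ x, (inner ℝ e x - m) ^ 2 = (inner ℝ e x ^ 2 - 2 * m * inner ℝ e x) + m ^ 2 := by
      intro x; ring
    simp_rw [this]
    have i3 : Integrable (fun x => inner ℝ e x ^ 2 - 2 * m * inner ℝ e x) (truncGaussian n K) :=
      (ii2 e he).sub ((ii e he).const_mul _)
    rw [integral_add i3 (integrable_const _),
      integral_sub (ii2 e he) ((ii e he).const_mul _), integral_const_mul, hin]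
    simp
  have hS : ∫ x, ‖x‖ ^ 2 ∂(truncGaussian n K) =
      ∑ i, ∫ x, inner ℝ (b i) x ^ 2 ∂(truncGaussian n K) := by
    rw [← integral_finsetSum _ fun i _ => ii2 _ (hb1 i)]
    refine integral_congr_ae (Filter.Eventually.of_forall fun x => ?_)
    have := b.sum_sq_norm_inner_right x
    simp only [Real.norm_eq_abs, sq_abs] at this
    exact this.symm
  have hMs : ∑ i, inner ℝ (b i) M ^ 2 = ‖M‖ ^ 2 := by
    have := b.sum_sq_norm_inner_right M
    simpa only [Real.norm_eq_abs, sq_abs] using this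
  have hle : ∀ i, ∫ x, inner ℝ (b i) x ^ 2 ∂(truncGaussian n K) ≤ 1 + inner ℝ (b i) M ^ 2 := by
    intro i
    have h1 := var_le_one cK mK hv (b i) (hb1 i) (inner ℝ (b i) M) (by rw [hsh _ (hb1 i)]; ring)
    rw [hsh2 _ (hb1 i)] at h1
    nlinarith
  have hle0 : ∫ x, inner ℝ (b i0) x ^ 2 ∂(truncGaussian n K) ≤ 0.6 + inner ℝ (b i0) M ^ 2 := by
    have h1 := slab_sq cK mK hv u hu (1/5) hK
    rw [hsh _ hu, hsh2 _ hu] at h1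
    obtain ⟨h1, h2⟩ := h1
    rw [hb]
    have h3 : inner ℝ u M ≤ ‖M‖ := by simpa [hu] using real_inner_le_norm u M
    have h4 : ‖M‖ < 0.245 := by
      by_contra hc
      push Not at hc
      nlinarith
    have h5 : inner ℝ u M - (-(1/5)) ≤ 0.445 := by linarith
    nlinarith
  rw [hS, ← Finset.add_sum_erase _ _ (Finset.mem_univ i0)]
  rw [← Finset.add_sum_erase _ _ (Finset.mem_univ i0)] at hMs
  have h6 := Finset.sum_le_sum (s := Finset.univ.erase i0) fun i _ => hle i
  rw [Finset.sum_add_distrib] at h6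
  have h7 : (∑ i ∈ Finset.univ.erase i0, (1:ℝ)) = n - 1 := by
    rw [Finset.sum_const, Finset.card_erase_of_mem (Finset.mem_univ _), Finset.card_univ,
      Fintype.card_fin, nsmul_eq_mul, mul_one, Nat.cast_sub (by omega)]
    simp
  linarith

lemma sep {n : ℕ} {K : Set (EuclideanSpace ℝ (Fin n))} (cK : Convex ℝ K)
    (clK : IsClosed K) (hne : K.Nonempty) (p : EuclideanSpace ℝ (Fin n)) (hp : p ∉ K)
    (hpr : ‖p‖ < 1/5) : ∃ u : EuclideanSpace ℝ (Fin n), ‖u‖ = 1 ∧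
      ∀ x ∈ K, -(1/5) ≤ inner ℝ u x := by
  obtain ⟨f, s, h1, h2⟩ := geometric_hahn_banach_closed_point cK clK hp
  set w := (InnerProductSpace.toDual ℝ (EuclideanSpace ℝ (Fin n))).symm f with hw
  have hf : ∀ x, f x = inner ℝ w x := fun x => by
    rw [hw, InnerProductSpace.toDual_symm_apply]
  have w0 : 0 < ‖w‖ := by
    rw [norm_pos_iff]
    intro h0
    obtain ⟨x, hx⟩ := hne
    have := h1 x hx
    rw [hf, h0] at this
    rw [hf, h0] at h2
    simp at this h2
    linarith
  refine ⟨-(‖w‖⁻¹ • w), ?_, fun x hx => ?_⟩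
  · rw [norm_neg, norm_smul, norm_inv, norm_norm, inv_mul_cancel₀ w0.ne']
  · have h3 := h1 x hx
    rw [hf] at h3 h2
    have h4 := real_inner_le_norm w p
    rw [inner_neg_left, real_inner_smul_left]
    have h5 : inner ℝ w x ≤ ‖w‖ * (1/5) := by nlinarith
    have : ‖w‖⁻¹ * inner ℝ w x ≤ ‖w‖⁻¹ * (‖w‖ * (1/5)) := by gcongr
    rw [inv_mul_cancel_left₀ w0.ne'] at this
    linarith

open scoped Pointwise in
lemma scal {n : ℕ} {K : Set (EuclideanSpace ℝ (Fin n))}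
    (mK : MeasurableSet K) (hv : 0 < (stdGaussian n K).toReal) (t : ℝ) (ht : 0 < t) :
    (stdGaussian n (t • K)).toReal = t ^ n * ((stdGaussian n K).toReal *
      ∫ x, Real.exp (-((t ^ 2 - 1) * ‖x‖ ^ 2 / 2)) ∂(truncGaussian n K)) := by
  have mt : MeasurableSet (t • K) := mK.const_smul_of_ne_zero ht.ne'
  have h1 : (stdGaussian n (t • K)).toReal = ∫ x in t • K, (1:ℝ) ∂(stdGaussian n) := by
    rw [setIntegral_const]; simp [Measure.real]
  have h2 : (stdGaussian n K).toReal *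
      ∫ x, Real.exp (-((t ^ 2 - 1) * ‖x‖ ^ 2 / 2)) ∂(truncGaussian n K) =
      ∫ x in K, Real.exp (-((t ^ 2 - 1) * ‖x‖ ^ 2 / 2)) ∂(stdGaussian n) := by
    unfold truncGaussian
    rw [integral_smul_measure, ENNReal.toReal_inv, smul_eq_mul, mul_inv_cancel_left₀ hv.ne']
  rw [h1, h2, integral_std n _ _ mt, integral_std n _ _ mK]
  have h3 := Measure.setIntegral_comp_smul_of_pos (volume : Measure (EuclideanSpace ℝ (Fin n)))
    (fun x => (2 * π) ^ (-(n : ℝ) / 2) * Real.exp (-‖x‖ ^ 2 / 2) * (1:ℝ)) K ht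
  rw [finrank_euclideanSpace_fin, smul_eq_mul] at h3
  have h4 : t ^ n ≠ 0 := by positivity
  rw [eq_comm, inv_mul_eq_iff_eq_mul₀ h4] at h3
  rw [h3]
  congr 1
  refine integral_congr_ae (Filter.Eventually.of_forall fun x => ?_)
  simp only [mul_one]
  rw [mul_assoc, ← Real.exp_add, norm_smul, Real.norm_of_nonneg ht.le]
  congr 2; ring

open scoped Pointwise in
lemma pl_mid {n : ℕ} {K : Set (EuclideanSpace ℝ (Fin n))} (cK : Convex ℝ K)
    (mK : MeasurableSet K) (ε : ℝ) (hε : 0 ≤ ε) :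
    (stdGaussian n K).toReal * (stdGaussian n ((1 + 2 * ε) • K)).toReal ≤
      (stdGaussian n ((1 + ε) • K)).toReal ^ 2 := by
  have m1 : MeasurableSet ((1 + 2 * ε) • K) := mK.const_smul_of_ne_zero (by positivity)
  have m2 : MeasurableSet ((1 + ε) • K) := mK.const_smul_of_ne_zero (by positivity)
  have := plg n (f := K.indicator 1) (g := ((1 + 2 * ε) • K).indicator 1)
    (h := ((1 + ε) • K).indicator 1) (measurable_one.indicator mK) (measurable_one.indicator m1)
    (measurable_one.indicator m2) ?_
  · rw [lintegral_indicator_one mK, lintegral_indicator_one m1, lintegral_indicator_one m2] at this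
    rw [← ENNReal.toReal_mul, ← ENNReal.toReal_pow]
    exact ENNReal.toReal_mono (by finiteness) this
  · intro x y
    by_cases hx : x ∈ K
    · by_cases hy : y ∈ (1 + 2 * ε) • K
      · have hm : (1/2 : ℝ) • (x + y) ∈ (1 + ε) • K := by
          obtain ⟨z, hz, rfl⟩ := hy
          refine ⟨(1 / (2 * (1 + ε))) • x + ((1 + 2 * ε) / (2 * (1 + ε))) • z,
            cK hx hz (by positivity) (by positivity) (by field_simp; ring), ?_⟩
          simp only [smul_add, smul_smul]
          congr 2 <;> field_simp
        rw [Set.indicator_of_mem hx, Set.indicator_of_mem hy, Set.indicator_of_mem hm]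
        simp only [Pi.one_apply, one_mul, one_pow]
        rw [ENNReal.ofReal_le_one, Real.exp_le_one_iff]
        have := sq_nonneg ‖x - y‖
        linarith
      · simp [Set.indicator_of_notMem hy]
    · simp [Set.indicator_of_notMem hx]

open scoped Pointwise in
lemma pl_iter {n : ℕ} {K : Set (EuclideanSpace ℝ (Fin n))} (cK : Convex ℝ K)
    (mK : MeasurableSet K) (L : ℝ)
    (hL : (stdGaussian n K).toReal * Real.exp L ≤ (stdGaussian n ((2:ℝ) • K)).toReal) (j : ℕ) :
    (stdGaussian n K).toReal * Real.exp (L * (1/2) ^ j) ≤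
      (stdGaussian n ((1 + (1/2) ^ j : ℝ) • K)).toReal := by
  induction j with
  | zero => 
    rw [pow_zero, mul_one]
    convert hL using 5
    norm_num
  | succ j ih =>
    have h1 := pl_mid (n := n) cK mK ((1/2) ^ (j + 1)) (by positivity)
    have e : 2 * (1/2 : ℝ) ^ (j + 1) = (1/2) ^ j := by rw [pow_succ]; ring
    rw [e] at h1
    refine (sq_le_sq₀ (by positivity) (by positivity)).1 (le_trans ?_ h1)
    have e2 : Real.exp (L * (1/2) ^ (j + 1)) ^ 2 = Real.exp (L * (1/2) ^ j) := by
      rw [← Real.exp_nat_mul]; congr 1; push_cast; rw [← e]; ring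
    rw [mul_pow, e2, sq, mul_assoc]
    gcongr

lemma exp_neg_le (z : ℝ) (hz : 0 ≤ z) : Real.exp (-z) ≤ 1 - z + z ^ 2 := by
  have h1 := Real.add_one_le_exp z
  have h2 : Real.exp (-z) * Real.exp z = 1 := by rw [← Real.exp_add]; simp
  have h3 := Real.exp_pos (-z)
  have h4 : Real.exp (-z) * (1 + z) ≤ 1 := by nlinarith
  have h5 : 1 ≤ (1 - z + z ^ 2) * (1 + z) := by nlinarith [pow_nonneg hz 3]
  exact le_of_mul_le_mul_right (h4.trans h5) (by linarith)

open scoped Pointwise in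
lemma deriv_bound {n : ℕ} {K : Set (EuclideanSpace ℝ (Fin n))} (cK : Convex ℝ K)
    (mK : MeasurableSet K) (hv : 0 < (stdGaussian n K).toReal) (L : ℝ)
    (hL : (stdGaussian n K).toReal * Real.exp L ≤ (stdGaussian n ((2:ℝ) • K)).toReal) :
    L ≤ n - ∫ x, ‖x‖ ^ 2 ∂(truncGaussian n K) := by
  have hP := trunc_prob hv
  have i2 : Integrable (fun x : EuclideanSpace ℝ (Fin n) => ‖x‖ ^ 2) (truncGaussian n K) := by
    refine trunc_int_poly hv (by fun_prop) 1 1 (by positivity) (by positivity) fun x => ?_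
    rw [abs_of_nonneg (by positivity)]
    linarith [sq_le_quart ‖x‖]
  have i4 : Integrable (fun x : EuclideanSpace ℝ (Fin n) => ‖x‖ ^ 4) (truncGaussian n K) := by
    refine trunc_int_poly hv (by fun_prop) 0 1 (by positivity) (by positivity) fun x => ?_
    rw [abs_of_nonneg (by positivity)]
    linarith
  set S := ∫ x, ‖x‖ ^ 2 ∂(truncGaussian n K) with hS
  set M := ∫ x, ‖x‖ ^ 4 ∂(truncGaussian n K) with hM
  have S0 : 0 ≤ S := integral_nonneg fun x => by positivity
  have M0 : 0 ≤ M := integral_nonneg fun x => by positivity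
  have key : ∀ j : ℕ, L ≤ n - S + 9 * M * (1/2) ^ j := by
    intro j
    have h1 := pl_iter (n := n) cK mK L hL j
    have e0 : (0:ℝ) < (1/2) ^ j := by positivity
    have e1 : ((1:ℝ)/2) ^ j ≤ 1 := pow_le_one₀ (by norm_num) (by norm_num)
    set ε : ℝ := (1/2) ^ j
    rw [scal mK hv (1 + ε) (by linarith)] at h1
    have hE : ∫ x, Real.exp (-(((1 + ε) ^ 2 - 1) * ‖x‖ ^ 2 / 2)) ∂(truncGaussian n K) ≤
        1 - ((1 + ε) ^ 2 - 1) / 2 * S + (((1 + ε) ^ 2 - 1) / 2) ^ 2 * M := by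
      set k := ((1 + ε) ^ 2 - 1) / 2 with hk
      have k0 : 0 ≤ k := by rw [hk]; nlinarith
      have i5 : Integrable (fun x : EuclideanSpace ℝ (Fin n) => 1 - k * ‖x‖ ^ 2)
        (truncGaussian n K) := (integrable_const _).sub (i2.const_mul _)
      have : ∫ x, (1 - k * ‖x‖ ^ 2 + k ^ 2 * ‖x‖ ^ 4) ∂(truncGaussian n K) =
          1 - k * S + k ^ 2 * M := by
        rw [integral_add i5 (i4.const_mul _), integral_sub (integrable_const _) (i2.const_mul _),
          integral_const_mul, integral_const_mul]
        simp [S, M]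
      rw [← this]
      refine integral_mono_of_nonneg (Filter.Eventually.of_forall fun x => by positivity)
        (i5.add (i4.const_mul _)) (Filter.Eventually.of_forall fun x => ?_)
      have h := exp_neg_le (k * ‖x‖ ^ 2) (by positivity)
      have e : ((1 + ε) ^ 2 - 1) * ‖x‖ ^ 2 / 2 = k * ‖x‖ ^ 2 := by rw [hk]; ring
      simp only
      rw [e]
      refine h.trans (le_of_eq ?_)
      ring
    set k := ((1 + ε) ^ 2 - 1) / 2 with hk
    have hE2 := hE.trans (show 1 - k * S + k ^ 2 * M ≤ Real.exp (-(k * S) + k ^ 2 * M) by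
      linarith [Real.add_one_le_exp (-(k * S) + k ^ 2 * M)])
    have hn : (1 + ε) ^ n ≤ Real.exp (n * ε) := by
      rw [Real.exp_nat_mul]
      gcongr
      linarith [Real.add_one_le_exp ε]
    have h2 : Real.exp (L * ε) ≤ Real.exp (n * ε) * Real.exp (-(k * S) + k ^ 2 * M) := by
      refine le_of_mul_le_mul_left (h1.trans ?_) hv
      rw [mul_left_comm]
      gcongr
    rw [← Real.exp_add, Real.exp_le_exp] at h2
    have k1 : ε ≤ k := by rw [hk]; nlinarith
    have k2 : k ≤ 3 * ε := by rw [hk]; nlinarith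
    have k3 : k ^ 2 ≤ (3 * ε) ^ 2 := by
      apply pow_le_pow_left₀ (by linarith) k2
    have h3 : ε * S ≤ k * S := by gcongr
    have h4 : k ^ 2 * M ≤ (3 * ε) ^ 2 * M := by gcongr
    refine le_of_mul_le_mul_right ?_ e0
    calc L * ε ≤ n * ε - ε * S + (3 * ε) ^ 2 * M := by linarith
      _ = _ := by ring
  have lim : Filter.Tendsto (fun j : ℕ => n - S + 9 * M * (1/2 : ℝ) ^ j) Filter.atTop
      (nhds (n - S + 9 * M * 0)) :=
    ((tendsto_pow_atTop_nhds_zero_of_lt_one (by norm_num) (by norm_num)).const_mul _).const_add _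
  have := ge_of_tendsto' lim key
  linarith

open scoped Pointwise in
lemma maurey {n : ℕ} {K : Set (EuclideanSpace ℝ (Fin n))} (cK : Convex ℝ K)
    (mK : MeasurableSet K) (hb : ∀ p, ‖p‖ < 1/5 → p ∈ K) :
    (stdGaussian n K).toReal ≤ (stdGaussian n ((2:ℝ) • K)).toReal *
      (1 - (1 - Real.exp (-(1/100))) * (1 - (stdGaussian n K).toReal)) := by
  have m2 : MeasurableSet ((2:ℝ) • K) := mK.const_smul_of_ne_zero (by norm_num)
  set A := (2:ℝ) • K with hA
  set p := ENNReal.ofReal (Real.exp (1/100)) with hp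
  set q := ENNReal.ofReal (Real.exp (-(1/100))) with hq
  have q1 : q ≤ 1 := by
    rw [hq, ENNReal.ofReal_le_one, Real.exp_le_one_iff]; norm_num
  have pq : p * q = 1 := by
    rw [hp, hq, ← ENNReal.ofReal_mul (by positivity), ← Real.exp_add]; simp
  have := plg n (f := fun x => A.indicator (fun _ => 1) x + Aᶜ.indicator (fun _ => p) x)
    (g := fun x => K.indicator (fun _ => 1) x + Kᶜ.indicator (fun _ => q) x)
    (h := fun _ => 1)
    ((measurable_const.indicator m2).add (measurable_const.indicator m2.compl))
    ((measurable_const.indicator mK).add (measurable_const.indicator mK.compl))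
    measurable_const ?_
  · rw [lintegral_add_left (measurable_const.indicator m2),
      lintegral_add_left (measurable_const.indicator mK),
      lintegral_indicator_const m2, lintegral_indicator_const m2.compl,
      lintegral_indicator_const mK, lintegral_indicator_const mK.compl,
      lintegral_const, measure_univ, mul_one, one_mul, one_mul, one_pow] at this
    have h := ENNReal.toReal_mono (by simp) this
    have cA : (stdGaussian n Aᶜ).toReal = 1 - (stdGaussian n A).toReal :=
      probReal_compl_eq_one_sub m2
    have cK' : (stdGaussian n Kᶜ).toReal = 1 - (stdGaussian n K).toReal :=
      probReal_compl_eq_one_sub mK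
    rw [ENNReal.toReal_mul, ENNReal.toReal_add (by finiteness) (by finiteness),
      ENNReal.toReal_add (by finiteness) (by finiteness), ENNReal.toReal_mul, ENNReal.toReal_mul,
      cA, cK', hp, hq, ENNReal.toReal_ofReal (by positivity),
      ENNReal.toReal_ofReal (by positivity), ENNReal.toReal_one] at h
    set v := (stdGaussian n K).toReal
    set v2 := (stdGaussian n A).toReal
    have e1 : Real.exp (1/100) * Real.exp (-(1/100)) = 1 := by rw [← Real.exp_add]; simp
    have e2 : Real.exp (-(1/100)) < 1 := by rw [Real.exp_lt_one_iff]; norm_num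
    have e3 := Real.exp_pos (-(1/100))
    set Q := Real.exp (-(1/100))
    set E := Real.exp (1/100)
    have h' : (v2 + E * (1 - v2)) * (v + Q * (1 - v)) * Q ≤ 1 * Q := by gcongr
    have h'' : (v2 + E * (1 - v2)) * (v + Q * (1 - v)) * Q =
      (v2 * Q + (E * Q) * (1 - v2)) * (v + Q * (1 - v)) := by ring
    rw [h'', e1] at h'
    refine le_of_mul_le_mul_left (a := 1 - Q) ?_ (by linarith)
    nlinarith
  · intro x y
    have ex1 : ENNReal.ofReal (Real.exp (-‖x - y‖ ^ 2 / 4)) ≤ 1 := by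
      rw [ENNReal.ofReal_le_one, Real.exp_le_one_iff]
      have := sq_nonneg ‖x - y‖
      linarith
    by_cases hx : x ∈ A
    · by_cases hy : y ∈ K
      · simpa [hx, hy] using ex1
      · simp only [hx, hy, Set.indicator_of_mem, Set.mem_compl_iff, not_true_eq_false,
          not_false_eq_true, Set.indicator_of_notMem, add_zero, zero_add, one_mul, one_pow]
        exact mul_le_one' q1 ex1
    · by_cases hy : y ∈ K
      · simp only [hx, hy, Set.indicator_of_mem, Set.mem_compl_iff, not_true_eq_false,
          not_false_eq_true, Set.indicator_of_notMem, add_zero, zero_add, mul_one, one_pow]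
        have hd : 1/5 ≤ ‖x - y‖ := by
          by_contra hc
          push Not at hc
          apply hx
          refine ⟨(1/2 : ℝ) • y + (1/2 : ℝ) • (x - y),
            cK hy (hb _ hc) (by norm_num) (by norm_num) (by norm_num), ?_⟩
          simp only [← smul_add, smul_smul]
          simp
        rw [hp, ← ENNReal.ofReal_mul (by positivity), ENNReal.ofReal_le_one, ← Real.exp_add,
          Real.exp_le_one_iff]
        nlinarith
      · simp only [hx, hy, Set.indicator_of_mem, Set.mem_compl_iff,
          not_false_eq_true, Set.indicator_of_notMem, zero_add, one_pow]
        rw [pq, one_mul]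
        exact ex1

lemma caseA {n : ℕ} {K : Set (EuclideanSpace ℝ (Fin n))} (cK : Convex ℝ K)
    (mK : MeasurableSet K) (hv : 0 < (stdGaussian n K).toReal)
    (hb : ∀ p, ‖p‖ < 1/5 → p ∈ K) :
    ∫ x, ‖x‖ ^ 2 ∂(truncGaussian n K) ≤
      n - (1 - Real.exp (-(1/100))) * (1 - (stdGaussian n K).toReal) := by
  have h1 := maurey cK mK hb
  set L := (1 - Real.exp (-(1/100))) * (1 - (stdGaussian n K).toReal)
  have h2 := deriv_bound cK mK hv L ?_
  · linarith
  · have h3 := Real.add_one_le_exp (-L)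
    have h4 : Real.exp (-L) * Real.exp L = 1 := by rw [← Real.exp_add]; simp
    refine (mul_le_mul_of_nonneg_right (h1.trans (mul_le_mul_of_nonneg_left
      (show 1 - L ≤ Real.exp (-L) by linarith) ENNReal.toReal_nonneg)) (Real.exp_pos L).le).trans
      (le_of_eq ?_)
    rw [mul_assoc, h4, mul_one]

lemma closed_case {n : ℕ} (hn : 2 ≤ n) {K : Set (EuclideanSpace ℝ (Fin n))} (cK : Convex ℝ K)
    (clK : IsClosed K) (hv : 0 < (stdGaussian n K).toReal)
    (hμ : ‖∫ x, x ∂(truncGaussian n K)‖ ^ 2 < 0.06) :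
    ∫ x, ‖x‖ ^ 2 ∂(truncGaussian n K) ≤
      n - (1 - Real.exp (-(1/100))) * (1 - (stdGaussian n K).toReal) := by
  by_cases hb : ∀ p, ‖p‖ < 1/5 → p ∈ K
  · exact caseA cK clK.measurableSet hv hb
  · push Not at hb
    obtain ⟨p, hp, hpK⟩ := hb
    have hne : K.Nonempty := by
      by_contra h
      rw [Set.not_nonempty_iff_eq_empty] at h
      simp [h] at hv
    obtain ⟨u, hu, hK⟩ := sep cK clK hne p hpK hp
    have h1 := caseB hn cK clK.measurableSet hv u hu hK hμ
    have h2 := Real.add_one_le_exp (-(1/100) : ℝ)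
    have h3 : Real.exp (-(1/100)) < 1 := by rw [Real.exp_lt_one_iff]; norm_num
    have h4 : (1 - Real.exp (-(1/100))) * (1 - (stdGaussian n K).toReal) ≤ 1 - Real.exp (-(1/100)) := by
      nlinarith
    linarith

/-- dichotomy for a general convex set `K` of positive Gaussian volume:
either its center of mass under `N(0,I_n)|K` has squared norm at least `0.06`, or the
expected squared norm drops below `n` by `min(c·(1 - vol K), 0.05)`. -/
theorem truncated_gaussian_dichotomy :
    ∃ c : ℝ, 0 < c ∧
      ∀ (n : ℕ), 2 ≤ n →
      ∀ (K : Set (EuclideanSpace ℝ (Fin n))),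
        Convex ℝ K → MeasurableSet K → 0 < (stdGaussian n K).toReal →
        ‖∫ x, x ∂(truncGaussian n K)‖ ^ 2 ≥ 0.06 ∨
        ∫ x, ‖x‖ ^ 2 ∂(truncGaussian n K)
          ≤ n - min (c * (1 - (stdGaussian n K).toReal)) 0.05 := by
  have h3 : Real.exp (-(1/100)) < 1 := by rw [Real.exp_lt_one_iff]; norm_num
  refine ⟨1 - Real.exp (-(1/100)), by linarith, ?_⟩
  intro n hn K cK _ hv
  have hac : _root_.stdGaussian n ≪ volume := withDensity_absolutelyContinuous _ _
  have hae : (closure K : Set (EuclideanSpace ℝ (Fin n))) =ᵐ[_root_.stdGaussian n] K := by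
    have h0 : (_root_.stdGaussian n) (frontier K) = 0 := hac (cK.addHaar_frontier volume)
    refine Filter.EventuallyLE.antisymm ?_ (Filter.Eventually.of_forall fun x hx => subset_closure hx)
    rw [ae_le_set]
    refine measure_mono_null ?_ h0
    intro x hx
    exact ⟨hx.1, fun h => hx.2 (interior_subset h)⟩
  have e1 : _root_.stdGaussian n (closure K) = _root_.stdGaussian n K := measure_congr hae
  have e2 : truncGaussian n (closure K) = truncGaussian n K := by
    unfold truncGaussian
    rw [e1, Measure.restrict_congr_set hae]
  by_cases hμ : ‖∫ x, x ∂(truncGaussian n K)‖ ^ 2 ≥ 0.06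
  · exact Or.inl hμ
  · right
    push Not at hμ
    have h := closed_case hn cK.closure isClosed_closure (by rw [e1]; exact hv) (by rw [e2]; exact hμ)
    rw [e1, e2] at h
    refine h.trans ?_
    have := min_le_left ((1 - Real.exp (-(1/100))) * (1 - (_root_.stdGaussian n K).toReal)) 0.05
    linarith
end

section
/- There exists n₀ ∈ ℕ such that for all n ≥ n₀, setting p = ⌊0.00001·(n−1)⌋, the total variation distance between the Wishart distributions Wis(p,n) and Wis(p,n−1) is at most 0.1; that is, for every measurable set A of p×p real matrices, |Wis(p,n)(A) − Wis(p,n−1)(A)| ≤ 0.1. -/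
open MeasureTheory ProbabilityTheory Real

/-- Matrices over `ℝ` carry the product measurable structure (entrywise). -/
instance matrixMeasurableSpace {p q : ℕ} : MeasurableSpace (Matrix (Fin p) (Fin q) ℝ) :=
  MeasurableSpace.pi

/-- The Wishart distribution `Wis(p, m)`: the law of `∑_{k=1}^m g_k g_kᵀ` for i.i.d.
standard Gaussian vectors `g_1, …, g_m` in `ℝᵖ`. -/
noncomputable def wishart (p m : ℕ) : Measure (Matrix (Fin p) (Fin p) ℝ) :=
  Measure.map
    (fun g : Fin m → EuclideanSpace ℝ (Fin p) =>
      ∑ k, Matrix.of fun i j => g k i * g k j)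
    (Measure.pi fun _ => stdGaussian p)

open scoped ENNReal Matrix

namespace WishartAux

/-- `n` row vectors in `ℝᵖ`. -/
abbrev X (p n : ℕ) := Fin n → EuclideanSpace ℝ (Fin p)

instance borelMat {p q : ℕ} : BorelSpace (Matrix (Fin p) (Fin q) ℝ) :=
  inferInstanceAs (BorelSpace (Fin p → Fin q → ℝ))

def mat {p n : ℕ} (Y : X p n) : Matrix (Fin n) (Fin p) ℝ := Matrix.of fun i j => Y i j

def gram {p n : ℕ} (Y : X p n) : Matrix (Fin p) (Fin p) ℝ :=
  ∑ k, Matrix.of fun i j => Y k i * Y k j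

lemma gram_eq {p n : ℕ} (Y : X p n) : gram Y = (mat Y)ᵀ * mat Y := by
  ext i j
  simp [gram, mat, Matrix.mul_apply, Matrix.sum_apply]

noncomputable def act {p n : ℕ} (A : Matrix (Fin p) (Fin p) ℝ) (Y : X p n) : X p n :=
  fun i => Matrix.toEuclideanLin Aᵀ (Y i)

lemma mat_act {p n : ℕ} (A : Matrix (Fin p) (Fin p) ℝ) (Y : X p n) :
    mat (act A Y) = mat Y * A := by
  ext i j
  simp [mat, act, Matrix.toEuclideanLin, Matrix.toLpLin_apply, Matrix.mul_apply, Matrix.mulVec, dotProduct, mul_comm]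

lemma gram_act {p n : ℕ} (A : Matrix (Fin p) (Fin p) ℝ) (Y : X p n) :
    gram (act A Y) = Aᵀ * gram Y * A := by
  rw [gram_eq, mat_act, gram_eq, Matrix.transpose_mul]
  simp only [Matrix.mul_assoc]

lemma continuous_mat {p n : ℕ} : Continuous (mat : X p n → _) := by
  unfold mat
  refine continuous_matrix fun i j => ?_
  simp only [Matrix.of_apply]
  fun_prop

lemma continuous_gram {p n : ℕ} : Continuous (gram : X p n → _) := by
  have : (gram : X p n → _) = fun Y => (mat Y)ᵀ * mat Y := funext gram_eq
  rw [this]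
  have := continuous_mat (p := p) (n := n)
  fun_prop

lemma gram_posSemidef {p n : ℕ} (Y : X p n) : (gram Y).PosSemidef := by
  rw [gram_eq]
  exact Matrix.posSemidef_conjTranspose_mul_self (mat Y)

lemma lintegral_act {p n : ℕ} {A : Matrix (Fin p) (Fin p) ℝ} (hA : A.det ≠ 0)
    {F : X p n → ℝ≥0∞} (hF : Measurable F) :
    ∫⁻ Y, F (act A Y) = ENNReal.ofReal ((|A.det| ^ n)⁻¹) * ∫⁻ Y, F Y := by
  set L : X p n →ₗ[ℝ] X p n :=
    LinearMap.pi (fun i => (Matrix.toEuclideanLin Aᵀ).comp (LinearMap.proj i)) with hL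
  have hdet : LinearMap.det L = A.det ^ n := by
    rw [hL, LinearMap.det_pi]
    simp [Matrix.toEuclideanLin]
  have hmap := Measure.map_linearMap_addHaar_eq_smul_addHaar (volume : Measure (X p n)) (f := L)
    (by rw [hdet]; exact pow_ne_zero _ hA)
  have hLm : Measurable L := L.continuous_of_finiteDimensional.measurable
  have h1 : ∫⁻ Y, F (act A Y) = ∫⁻ Y, F Y ∂(Measure.map L volume) := by
    rw [lintegral_map hF hLm]
    rfl
  rw [h1, hmap, lintegral_smul_measure, hdet, abs_inv, abs_pow, smul_eq_mul]

/-- almost every `Y` has nonsingular Gram matrix -/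
lemma ae_det_gram_ne {p n : ℕ} (h : p ≤ n) : ∀ᵐ Y : X p n, (gram Y).det ≠ 0 := by
  set N : Set (X p n) := {Y | (gram Y).det = 0} with hN
  have hNm : MeasurableSet N := by
    have : Continuous fun Y : X p n => (gram Y).det := continuous_gram.matrix_det
    exact (isClosed_singleton.preimage this).measurableSet
  let E : X p n := fun i => WithLp.toLp 2 fun j => if i = Fin.castLE h j then 1 else 0
  have hnull : ∀ Y : X p n, volume {t : ℝ | Y + t • E ∈ N} = 0 := by
    intro Y
    let T : Matrix (Fin p) (Fin p) ℝ := Matrix.of fun i j => Y (Fin.castLE h i) j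
    refine Set.Finite.measure_zero (Set.Finite.subset
      (Polynomial.finite_setOfPred_isRoot (Matrix.charpoly_monic (-T)).ne_zero) ?_) _
    intro t ht
    simp only [Set.mem_ofPred_eq, hN] at ht ⊢
    obtain ⟨v, hv0, hv⟩ := Matrix.exists_mulVec_eq_zero_iff.mpr ht
    have hv2 : mat (Y + t • E) *ᵥ v = 0 := by
      rw [gram_eq] at hv
      have : (mat (Y + t • E) *ᵥ v) ⬝ᵥ (mat (Y + t • E) *ᵥ v) = 0 := by
        rw [Matrix.dotProduct_mulVec, Matrix.vecMul_mulVec, ← Matrix.dotProduct_mulVec, hv]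
        simp
      exact dotProduct_self_eq_zero.mp this
    rw [Polynomial.IsRoot, Matrix.eval_charpoly, ← Matrix.exists_mulVec_eq_zero_iff]
    refine ⟨v, hv0, ?_⟩
    ext i
    have := congrFun hv2 (Fin.castLE h i)
    simp only [Matrix.mulVec, dotProduct, mat, Matrix.of_apply, Pi.add_apply, Pi.smul_apply, PiLp.add_apply, PiLp.smul_apply, E, Pi.zero_apply, smul_eq_mul] at this ⊢
    rw [← this]
    refine Finset.sum_congr rfl fun j _ => ?_
    by_cases hij : i = j
    · subst hij; simp [T, add_comm]
    · have : ¬ (Fin.castLE h i = Fin.castLE h j) := fun h' => hij (Fin.castLE_injective h h')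
      simp [T, hij]
  have hmeas : Measurable fun q : ℝ × X p n => q.2 + q.1 • E := by fun_prop
  have key : ∫⁻ t in Set.Icc (0:ℝ) 1, volume N = 0 := by
    have h1 : ∀ t : ℝ, volume N = ∫⁻ Y : X p n, N.indicator 1 (Y + t • E) := by
      intro t
      rw [lintegral_add_right_eq_self (μ := volume) (N.indicator (1 : X p n → ℝ≥0∞)) (t • E), lintegral_indicator_one hNm]
    rw [show (fun t : ℝ => volume N) = fun t : ℝ => ∫⁻ Y : X p n, N.indicator (1 : X p n → ℝ≥0∞) (Y + t • E) from funext h1]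
    rw [lintegral_lintegral_swap]
    · rw [← lintegral_zero (μ := (volume : Measure (X p n)))]
      refine lintegral_congr fun Y => ?_
      refine le_antisymm ?_ bot_le
      refine (setLIntegral_le_lintegral _ _).trans ?_
      have : (fun t : ℝ => N.indicator (1 : X p n → ℝ≥0∞) (Y + t • E)) = Set.indicator {t : ℝ | Y + t • E ∈ N} 1 := by
        ext t; simp [Set.indicator]
      rw [this]
      refine (lintegral_indicator_one_le _).trans ?_
      rw [hnull]
    · exact ((measurable_one.indicator hNm).comp hmeas).aemeasurable
  simp at key
  rw [ae_iff]
  simpa [hN] using key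

/-- Gaussian weight. -/
noncomputable def kk {p : ℕ} (S : Matrix (Fin p) (Fin p) ℝ) : ℝ≥0∞ :=
  ENNReal.ofReal (Real.exp (-S.trace / 2))

lemma measurable_kk {p : ℕ} : Measurable (kk (p := p)) := by
  unfold kk
  have : Continuous fun S : Matrix (Fin p) (Fin p) ℝ => S.trace := continuous_id.matrix_trace
  have := this.measurable
  fun_prop

lemma measurable_matinv {p : ℕ} :
    Measurable (fun S : Matrix (Fin p) (Fin p) ℝ => S⁻¹) := by
  simp only [Matrix.inv_def, Ring.inverse_eq_inv']
  have h1 : Measurable fun S : Matrix (Fin p) (Fin p) ℝ => S.det :=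
    continuous_id.matrix_det.measurable
  have h2 : Measurable fun S : Matrix (Fin p) (Fin p) ℝ => S.adjugate :=
    continuous_id.matrix_adjugate.measurable
  refine measurable_pi_iff.mpr fun i => measurable_pi_iff.mpr fun j => ?_
  have h3 : Measurable fun S : Matrix (Fin p) (Fin p) ℝ => S.adjugate i j :=
    (measurable_pi_apply j).comp ((measurable_pi_apply i).comp h2)
  exact h1.inv.mul h3

lemma meas_mul {α : Type*} [MeasurableSpace α] {p : ℕ} {a b : α → Matrix (Fin p) (Fin p) ℝ}
    (ha : Measurable a) (hb : Measurable b) : Measurable fun x => a x * b x := by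
  refine measurable_pi_iff.mpr fun i => measurable_pi_iff.mpr fun j => ?_
  simp only [Matrix.mul_apply]
  refine Finset.measurable_sum _ fun k _ => ?_
  exact ((measurable_pi_apply k).comp ((measurable_pi_apply i).comp ha)).mul
    ((measurable_pi_apply j).comp ((measurable_pi_apply k).comp hb))

lemma det_gram_sq {p : ℕ} (G : X p p) : (gram G).det = (mat G).det ^ 2 := by
  rw [gram_eq, Matrix.det_mul, Matrix.det_transpose, sq]

lemma ae_det_mat_ne {p : ℕ} : ∀ᵐ G : X p p, (mat G).det ≠ 0 := by
  filter_upwards [ae_det_gram_ne (le_refl p)] with G hG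
  intro h
  apply hG
  rw [det_gram_sq, h]; simp

lemma exists_sqrt {p n : ℕ} (Y : X p n) : ∃ R : Matrix (Fin p) (Fin p) ℝ,
    Rᵀ = R ∧ R * R = gram Y ∧ |R.det| = √((gram Y).det) := by
  have hS := gram_posSemidef Y
  obtain ⟨R, hR, hRR⟩ : ∃ R : Matrix (Fin p) (Fin p) ℝ, Rᵀ = R ∧ R * R = gram Y := by
    open scoped MatrixOrder Matrix.Norms.L2Operator in
    refine ⟨CFC.sqrt (gram Y), ?_, CFC.sqrt_mul_sqrt_self _ hS.nonneg⟩
    have := (Matrix.nonneg_iff_posSemidef.mp (CFC.sqrt_nonneg (gram Y))).isHermitian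
    simpa [Matrix.IsHermitian] using this
  refine ⟨R, hR, hRR, ?_⟩
  rw [← hRR, Matrix.det_mul, Real.sqrt_mul_self_eq_abs]

noncomputable def C1 (p : ℕ) : ℝ≥0∞ := ∫⁻ G : X p p, kk (mat G * (mat G)ᵀ)

noncomputable def C2 (p n : ℕ) : ℝ≥0∞ :=
  ∫⁻ Y : X p n, ENNReal.ofReal ((√((gram Y).det) ^ (p + n))⁻¹) * kk (gram Y)⁻¹

noncomputable def KK (p n : ℕ) (f : Matrix (Fin p) (Fin p) ℝ → ℝ≥0∞) : ℝ≥0∞ :=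
  ∫⁻ G : X p p, ENNReal.ofReal (|(mat G).det| ^ (n - p)) * f (mat G * (mat G)ᵀ)

noncomputable def II (p n : ℕ) (f : Matrix (Fin p) (Fin p) ℝ → ℝ≥0∞) : ℝ≥0∞ :=
  ∫⁻ Y : X p n, f (gram Y)

lemma step1 {p n : ℕ} {f : Matrix (Fin p) (Fin p) ℝ → ℝ≥0∞} (hf : Measurable f) :
    C1 p * II p n f = ∫⁻ G : X p p, ∫⁻ Y : X p n,
      ENNReal.ofReal (|(mat G).det| ^ n) * kk (mat G * (mat G)ᵀ) *
        f (mat G * gram Y * (mat G)ᵀ) := by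
  have hm := (continuous_mat (p := p) (n := p)).measurable
  have hmm : Measurable fun G : X p p => mat G * (mat G)ᵀ := by
    have := continuous_mat (p := p) (n := p)
    exact Continuous.measurable (by fun_prop)
  have hkm : Measurable fun G : X p p => kk (mat G * (mat G)ᵀ) := measurable_kk.comp hmm
  rw [C1, ← lintegral_mul_const _ hkm]
  refine lintegral_congr_ae ?_
  filter_upwards [ae_det_mat_ne] with G hG
  have hfg : Measurable fun Y : X p n => f (gram Y) := hf.comp continuous_gram.measurable
  have h1 : Measurable fun Y : X p n => f (mat G * gram Y * (mat G)ᵀ) := by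
    have := continuous_gram (p := p) (n := n)
    exact hf.comp (Continuous.measurable (by fun_prop))
  rw [lintegral_const_mul _ h1]
  have h2 := lintegral_act (n := n) (A := (mat G)ᵀ) (by rwa [Matrix.det_transpose]) hfg
  simp only [gram_act, Matrix.transpose_transpose, Matrix.det_transpose] at h2
  rw [h2, II]
  have h3 : ENNReal.ofReal (|(mat G).det| ^ n) * ENNReal.ofReal ((|(mat G).det| ^ n)⁻¹) = 1 := by
    rw [← ENNReal.ofReal_mul (by positivity), mul_inv_cancel₀, ENNReal.ofReal_one]
    exact pow_ne_zero _ (abs_ne_zero.mpr hG)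
  calc _ = 1 * (kk (mat G * (mat G)ᵀ) * ∫⁻ Y : X p n, f (gram Y)) := by rw [one_mul]
    _ = _ := by rw [← h3]; ring

lemma step2 {p n : ℕ} (hpn : p ≤ n) {f : Matrix (Fin p) (Fin p) ℝ → ℝ≥0∞} (hf : Measurable f) :
    (∫⁻ Y : X p n, ∫⁻ G : X p p,
      ENNReal.ofReal (|(mat G).det| ^ n) * kk (mat G * (mat G)ᵀ) *
        f (mat G * gram Y * (mat G)ᵀ)) =
    ∫⁻ Y : X p n, ∫⁻ G : X p p, ENNReal.ofReal ((√((gram Y).det) ^ (p + n))⁻¹) *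
      (ENNReal.ofReal (|(mat G).det| ^ n) * kk (mat G * (gram Y)⁻¹ * (mat G)ᵀ) *
        f (mat G * (mat G)ᵀ)) := by
  refine lintegral_congr_ae ?_
  filter_upwards [ae_det_gram_ne hpn] with Y hY
  obtain ⟨R, hRt, hRR, hRd⟩ := exists_sqrt Y
  have hR0 : R.det ≠ 0 := by
    intro h; apply hY; rw [← hRR, Matrix.det_mul, h]; simp
  have hRu : IsUnit R.det := isUnit_iff_ne_zero.mpr hR0
  have hcm := continuous_mat (p := p) (n := p)
  have hm1 : Measurable fun G : X p p => |(mat G).det| ^ n :=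
    Continuous.measurable (by fun_prop)
  have hm2 : Measurable fun G : X p p => kk (mat G * (gram Y)⁻¹ * (mat G)ᵀ) :=
    measurable_kk.comp (Continuous.measurable (by fun_prop))
  have hm3 : Measurable fun G : X p p => f (mat G * (mat G)ᵀ) :=
    hf.comp (Continuous.measurable (by fun_prop))
  have hF : Measurable fun G : X p p => (ENNReal.ofReal (|(mat G).det| ^ n) *
      kk (mat G * (gram Y)⁻¹ * (mat G)ᵀ) * f (mat G * (mat G)ᵀ)) :=
    (hm1.ennreal_ofReal.mul hm2).mul hm3
  have h := lintegral_act hR0 hF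
  rw [lintegral_const_mul _ hF, ← hRd]
  have hinv : R * (gram Y)⁻¹ * R = 1 := by
    rw [← hRR, Matrix.mul_inv_rev, ← Matrix.mul_assoc R, Matrix.mul_nonsing_inv _ hRu,
      Matrix.one_mul, Matrix.nonsing_inv_mul _ hRu]
  have hterm : ∀ G : X p p, ENNReal.ofReal (|(mat (act R G)).det| ^ n) *
      kk (mat (act R G) * (gram Y)⁻¹ * (mat (act R G))ᵀ) * f (mat (act R G) * (mat (act R G))ᵀ)
      = ENNReal.ofReal (|R.det| ^ n) * (ENNReal.ofReal (|(mat G).det| ^ n) * kk (mat G * (mat G)ᵀ) *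
        f (mat G * gram Y * (mat G)ᵀ)) := by
    intro G
    rw [mat_act, Matrix.transpose_mul, hRt, Matrix.det_mul, abs_mul, mul_pow,
      ENNReal.ofReal_mul (by positivity)]
    have e1 : mat G * R * (gram Y)⁻¹ * (R * (mat G)ᵀ) = mat G * (mat G)ᵀ := by
      calc _ = mat G * (R * (gram Y)⁻¹ * R) * (mat G)ᵀ := by simp only [Matrix.mul_assoc]
        _ = _ := by rw [hinv, Matrix.mul_one]
    have e2 : mat G * R * (R * (mat G)ᵀ) = mat G * gram Y * (mat G)ᵀ := by
      rw [← hRR]; simp only [Matrix.mul_assoc]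
    rw [e1, e2]; ring
  simp only [hterm] at h
  have hm4 : Measurable fun G : X p p => kk (mat G * (mat G)ᵀ) :=
    measurable_kk.comp (Continuous.measurable (by fun_prop))
  have hm5 : Measurable fun G : X p p => f (mat G * gram Y * (mat G)ᵀ) :=
    hf.comp (Continuous.measurable (by fun_prop))
  have hm6 : Measurable fun G : X p p => ENNReal.ofReal (|(mat G).det| ^ n) *
      kk (mat G * (mat G)ᵀ) * f (mat G * gram Y * (mat G)ᵀ) :=
    (hm1.ennreal_ofReal.mul hm4).mul hm5
  rw [lintegral_const_mul _ hm6] at h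
  have h3 : ENNReal.ofReal ((|R.det| ^ n)⁻¹) * ENNReal.ofReal (|R.det| ^ n) = 1 := by
    rw [← ENNReal.ofReal_mul (by positivity), inv_mul_cancel₀, ENNReal.ofReal_one]
    exact pow_ne_zero _ (abs_ne_zero.mpr hR0)
  rw [pow_add, mul_inv, ENNReal.ofReal_mul (by positivity), mul_right_comm, ← h,
    mul_comm, ← mul_assoc, h3, one_mul]

lemma step3 {p n : ℕ} (hpn : p ≤ n) {f : Matrix (Fin p) (Fin p) ℝ → ℝ≥0∞} :
    (∫⁻ G : X p p, ∫⁻ Y : X p n, ENNReal.ofReal ((√((gram Y).det) ^ (p + n))⁻¹) *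
      (ENNReal.ofReal (|(mat G).det| ^ n) * kk (mat G * (gram Y)⁻¹ * (mat G)ᵀ) *
        f (mat G * (mat G)ᵀ))) =
    ∫⁻ G : X p p, (ENNReal.ofReal (|(mat G).det| ^ (n - p)) * f (mat G * (mat G)ᵀ)) * C2 p n := by
  refine lintegral_congr_ae ?_
  filter_upwards [ae_det_mat_ne] with G hG
  have hGu : IsUnit (mat G).det := isUnit_iff_ne_zero.mpr hG
  have hcg := continuous_gram (p := p) (n := n)
  have hm1 : Measurable fun Y : X p n => (√((gram Y).det) ^ (p + n))⁻¹ :=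
    Measurable.inv (Continuous.measurable (by fun_prop))
  have hs : Measurable fun S : Matrix (Fin p) (Fin p) ℝ => mat G * S * (mat G)ᵀ :=
    Continuous.measurable (by fun_prop)
  have hm2 : Measurable fun Y : X p n => kk (mat G * (gram Y)⁻¹ * (mat G)ᵀ) :=
    measurable_kk.comp (hs.comp (measurable_matinv.comp hcg.measurable))
  have hm3 : Measurable fun Y : X p n => kk (gram Y)⁻¹ :=
    measurable_kk.comp (measurable_matinv.comp hcg.measurable)
  have hF : Measurable fun Y : X p n => ENNReal.ofReal ((√((gram Y).det) ^ (p + n))⁻¹) *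
      kk (mat G * (gram Y)⁻¹ * (mat G)ᵀ) := hm1.ennreal_ofReal.mul hm2
  have h := lintegral_act hG hF
  have hterm : ∀ Y : X p n, ENNReal.ofReal ((√((gram (act (mat G) Y)).det) ^ (p + n))⁻¹) *
      kk (mat G * (gram (act (mat G) Y))⁻¹ * (mat G)ᵀ) =
      ENNReal.ofReal ((|(mat G).det| ^ (p + n))⁻¹) *
      (ENNReal.ofReal ((√((gram Y).det) ^ (p + n))⁻¹) * kk (gram Y)⁻¹) := by
    intro Y
    have e1 : mat G * (gram (act (mat G) Y))⁻¹ * (mat G)ᵀ = (gram Y)⁻¹ := by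
      have hGt : IsUnit ((mat G)ᵀ).det := by rwa [Matrix.det_transpose]
      rw [gram_act, Matrix.mul_inv_rev, Matrix.mul_inv_rev]
      calc _ = (mat G * (mat G)⁻¹) * (gram Y)⁻¹ * (((mat G)ᵀ)⁻¹ * (mat G)ᵀ) := by
            simp only [Matrix.mul_assoc]
        _ = _ := by
            rw [Matrix.mul_nonsing_inv _ hGu, Matrix.nonsing_inv_mul _ hGt, Matrix.one_mul,
              Matrix.mul_one]
    have e2 : √((gram (act (mat G) Y)).det) = |(mat G).det| * √((gram Y).det) := by
      rw [gram_act, Matrix.det_mul, Matrix.det_mul, Matrix.det_transpose, mul_right_comm,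
        Real.sqrt_mul (mul_self_nonneg _), Real.sqrt_mul_self_eq_abs]
    rw [e1, e2, mul_pow, mul_inv, ENNReal.ofReal_mul (by positivity), mul_assoc]
  simp only [hterm] at h
  have hm4 : Measurable fun Y : X p n => ENNReal.ofReal ((√((gram Y).det) ^ (p + n))⁻¹) *
      kk (gram Y)⁻¹ := hm1.ennreal_ofReal.mul hm3
  rw [lintegral_const_mul _ hm4] at h
  have e3 : ∀ Y : X p n, ENNReal.ofReal ((√((gram Y).det) ^ (p + n))⁻¹) *
      (ENNReal.ofReal (|(mat G).det| ^ n) * kk (mat G * (gram Y)⁻¹ * (mat G)ᵀ) *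
        f (mat G * (mat G)ᵀ)) = (ENNReal.ofReal (|(mat G).det| ^ n) * f (mat G * (mat G)ᵀ)) *
        (ENNReal.ofReal ((√((gram Y).det) ^ (p + n))⁻¹) *
      kk (mat G * (gram Y)⁻¹ * (mat G)ᵀ)) := fun Y => by ring
  simp only [e3]
  rw [lintegral_const_mul _ hF]
  set d := |(mat G).det| with hd
  have hd0 : 0 < d := abs_pos.mpr hG
  have hI : (∫⁻ Y : X p n, ENNReal.ofReal ((√((gram Y).det) ^ (p + n))⁻¹) *
      kk (mat G * (gram Y)⁻¹ * (mat G)ᵀ)) = ENNReal.ofReal ((d ^ p)⁻¹) * C2 p n := by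
    have h4 : ENNReal.ofReal (d ^ n) * ENNReal.ofReal ((d ^ n)⁻¹) = 1 := by
      rw [← ENNReal.ofReal_mul (by positivity), mul_inv_cancel₀ (by positivity),
        ENNReal.ofReal_one]
    calc _ = ENNReal.ofReal (d ^ n) * (ENNReal.ofReal ((d ^ n)⁻¹) * _) := by
          rw [← mul_assoc, h4, one_mul]
      _ = _ := by
          rw [← h, ← mul_assoc, ← ENNReal.ofReal_mul (by positivity), C2]
          congr 2
          rw [pow_add]; field_simp
  rw [hI]
  have h5 : ENNReal.ofReal (d ^ n) * ENNReal.ofReal ((d ^ p)⁻¹) = ENNReal.ofReal (d ^ (n - p)) := by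
    rw [← ENNReal.ofReal_mul (by positivity), pow_sub₀ _ hd0.ne' hpn]
  rw [← h5]; ring

lemma meas_J1 {p n : ℕ} {f : Matrix (Fin p) (Fin p) ℝ → ℝ≥0∞} (hf : Measurable f) :
    Measurable fun q : X p p × X p n => ENNReal.ofReal (|(mat q.1).det| ^ n) *
      kk (mat q.1 * (mat q.1)ᵀ) * f (mat q.1 * gram q.2 * (mat q.1)ᵀ) := by
  have hcm : Continuous fun q : X p p × X p n => mat q.1 := continuous_mat.comp continuous_fst
  have hcg : Continuous fun q : X p p × X p n => gram q.2 := continuous_gram.comp continuous_snd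
  have hm1 : Measurable fun q : X p p × X p n => |(mat q.1).det| ^ n :=
    (hcm.matrix_det.abs.pow n).measurable
  have hm2 : Measurable fun q : X p p × X p n => kk (mat q.1 * (mat q.1)ᵀ) :=
    measurable_kk.comp (hcm.matrix_mul hcm.matrix_transpose).measurable
  have hm3 : Measurable fun q : X p p × X p n => f (mat q.1 * gram q.2 * (mat q.1)ᵀ) :=
    hf.comp ((hcm.matrix_mul hcg).matrix_mul hcm.matrix_transpose).measurable
  exact (hm1.ennreal_ofReal.mul hm2).mul hm3

lemma meas_J2 {p n : ℕ} {f : Matrix (Fin p) (Fin p) ℝ → ℝ≥0∞} (hf : Measurable f) :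
    Measurable fun q : X p n × X p p => ENNReal.ofReal ((√((gram q.1).det) ^ (p + n))⁻¹) *
      (ENNReal.ofReal (|(mat q.2).det| ^ n) * kk (mat q.2 * (gram q.1)⁻¹ * (mat q.2)ᵀ) *
        f (mat q.2 * (mat q.2)ᵀ)) := by
  have hcm : Continuous fun q : X p n × X p p => mat q.2 := continuous_mat.comp continuous_snd
  have hcg : Continuous fun q : X p n × X p p => gram q.1 := continuous_gram.comp continuous_fst
  have hm1 : Measurable fun q : X p n × X p p => |(mat q.2).det| ^ n :=
    (hcm.matrix_det.abs.pow n).measurable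
  have g1 : Measurable fun q : X p n × X p p => (√((gram q.1).det) ^ (p + n))⁻¹ :=
    (hcg.matrix_det.sqrt.pow (p + n)).measurable.inv
  have hgi : Measurable fun q : X p n × X p p => (gram q.1)⁻¹ :=
    measurable_matinv.comp hcg.measurable
  have hpm2 : Measurable fun q : X p n × X p p => mat q.2 * (gram q.1)⁻¹ * (mat q.2)ᵀ :=
    meas_mul (meas_mul hcm.measurable hgi) hcm.matrix_transpose.measurable
  have hg2 : Measurable fun q : X p n × X p p => kk (mat q.2 * (gram q.1)⁻¹ * (mat q.2)ᵀ) :=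
    measurable_kk.comp hpm2
  have g3 : Measurable fun q : X p n × X p p => f (mat q.2 * (mat q.2)ᵀ) :=
    hf.comp (hcm.matrix_mul hcm.matrix_transpose).measurable
  exact g1.ennreal_ofReal.mul ((hm1.ennreal_ofReal.mul hg2).mul g3)

lemma meas_K {p : ℕ} (n : ℕ) {f : Matrix (Fin p) (Fin p) ℝ → ℝ≥0∞} (hf : Measurable f) :
    Measurable fun G : X p p => ENNReal.ofReal (|(mat G).det| ^ n) * f (mat G * (mat G)ᵀ) := by
  have hcm := continuous_mat (p := p) (n := p)
  have h1 : Measurable fun G : X p p => |(mat G).det| ^ n := (hcm.matrix_det.abs.pow n).measurable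
  have h2 : Measurable fun G : X p p => f (mat G * (mat G)ᵀ) :=
    hf.comp (hcm.matrix_mul hcm.matrix_transpose).measurable
  exact h1.ennreal_ofReal.mul h2

lemma main_id {p n : ℕ} (hpn : p ≤ n) {f : Matrix (Fin p) (Fin p) ℝ → ℝ≥0∞}
    (hf : Measurable f) : C1 p * II p n f = KK p n f * C2 p n := by
  have h1 := lintegral_lintegral_swap (μ := (volume : Measure (X p p)))
    (ν := (volume : Measure (X p n))) (f := fun G Y => ENNReal.ofReal (|(mat G).det| ^ n) *
      kk (mat G * (mat G)ᵀ) * f (mat G * gram Y * (mat G)ᵀ)) (meas_J1 hf).aemeasurable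
  have h2 := lintegral_lintegral_swap (μ := (volume : Measure (X p n)))
    (ν := (volume : Measure (X p p)))
    (f := fun Y G => ENNReal.ofReal ((√((gram Y).det) ^ (p + n))⁻¹) *
      (ENNReal.ofReal (|(mat G).det| ^ n) * kk (mat G * (gram Y)⁻¹ * (mat G)ᵀ) *
        f (mat G * (mat G)ᵀ))) (meas_J2 hf).aemeasurable
  have h3 := lintegral_mul_const (μ := (volume : Measure (X p p))) (C2 p n) (meas_K (n - p) hf)
  exact (step1 hf).trans (h1.trans ((step2 hpn hf).trans (h2.trans ((step3 hpn).trans h3))))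

lemma lintegral_pi_prod {α : Type*} [MeasurableSpace α] (ν : Measure α) [SigmaFinite ν] :
    ∀ (n : ℕ) (g : Fin n → α → ℝ≥0∞), (∀ i, Measurable (g i)) →
    ∫⁻ x : Fin n → α, ∏ i, g i (x i) ∂(Measure.pi fun _ => ν) = ∏ i, ∫⁻ y, g i y ∂ν := by
  intro n
  induction n with
  | zero => intro g _; simp
  | succ n ih =>
    intro g hg
    have hmp := (measurePreserving_piFinSuccAbove (fun _ : Fin (n + 1) => ν) 0).symm
    rw [← hmp.lintegral_comp (by fun_prop)]
    simp_rw [MeasurableEquiv.piFinSuccAbove_symm_apply, Fin.insertNthEquiv,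
        Fin.prod_univ_succ, Fin.insertNth_zero]
    simp only [Equiv.coe_fn_mk, Fin.cons_zero, Fin.cons_succ]
    rw [← ih (fun i => g i.succ) (fun i => hg _)]
    exact lintegral_prod_mul (μ := ν) (ν := Measure.pi fun _ : Fin n => ν) (hg 0).aemeasurable
      (g := fun x => ∏ i, g i.succ (x i)) (Finset.measurable_prod _ fun i _ =>
      (hg i.succ).comp (measurable_pi_apply i)).aemeasurable

lemma pi_withDensity {α : Type*} [MeasurableSpace α] (ν : Measure α) [SigmaFinite ν]
    (g : α → ℝ≥0∞) (hg : Measurable g) [SigmaFinite (ν.withDensity g)] (n : ℕ) :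
    (Measure.pi fun _ : Fin n => ν.withDensity g) =
      (Measure.pi fun _ : Fin n => ν).withDensity fun x => ∏ i, g (x i) := by
  refine Measure.pi_eq fun s hs => ?_
  rw [withDensity_apply _ (MeasurableSet.univ_pi hs), ← lintegral_indicator (MeasurableSet.univ_pi hs)]
  have : ∀ x : Fin n → α, (Set.univ.pi s).indicator (fun x => ∏ i, g (x i)) x =
      ∏ i, (s i).indicator g (x i) := by
    intro x
    by_cases hx : x ∈ Set.univ.pi s
    · rw [Set.indicator_of_mem hx]
      refine Finset.prod_congr rfl fun i _ => ?_
      rw [Set.indicator_of_mem (hx i (Set.mem_univ i))]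
    · rw [Set.indicator_of_notMem hx]
      simp only [Set.mem_pi, Set.mem_univ, forall_true_left, not_forall] at hx
      obtain ⟨i, hi⟩ := hx
      exact (Finset.prod_eq_zero (Finset.mem_univ i) (Set.indicator_of_notMem hi _)).symm
  simp only [this]
  rw [lintegral_pi_prod ν n _ (fun i => hg.indicator (hs i))]
  refine Finset.prod_congr rfl fun i _ => ?_
  rw [withDensity_apply _ (hs i), lintegral_indicator (hs i)]

noncomputable def gd (p : ℕ) (x : EuclideanSpace ℝ (Fin p)) : ℝ≥0∞ :=
  ENNReal.ofReal ((2 * π) ^ (-(p : ℝ) / 2) * Real.exp (-‖x‖ ^ 2 / 2))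

lemma measurable_gd (p : ℕ) : Measurable (gd p) := by
  unfold gd; fun_prop

instance prob_std (p : ℕ) : IsProbabilityMeasure (_root_.stdGaussian p) := by
  constructor
  unfold _root_.stdGaussian
  rw [withDensity_apply _ MeasurableSet.univ, Measure.restrict_univ]
  have h := GaussianFourier.integral_rexp_neg_mul_sq_norm (V := EuclideanSpace ℝ (Fin p))
    (b := 1 / 2) (by norm_num)
  have hpos : (0:ℝ) < (2 * π) ^ ((p : ℝ) / 2) := by positivity
  have h' : ∫ v : EuclideanSpace ℝ (Fin p), Real.exp (-‖v‖ ^ 2 / 2) = (2 * π) ^ ((p : ℝ) / 2) := by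
    have e : ∀ v : EuclideanSpace ℝ (Fin p), -‖v‖ ^ 2 / 2 = -(1 / 2) * ‖v‖ ^ 2 := fun v => by ring
    simp only [e]
    rw [h]
    simp
    ring_nf
  have hIntg : Integrable fun v : EuclideanSpace ℝ (Fin p) => Real.exp (-‖v‖ ^ 2 / 2) := by
    by_contra hn
    rw [integral_undef hn] at h'
    exact hpos.ne h'
  rw [← ofReal_integral_eq_lintegral_ofReal (hIntg.const_mul _)
    (Filter.Eventually.of_forall fun x => by positivity), integral_const_mul, h',
    ← Real.rpow_add (by positivity)]
  simp [neg_div]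

noncomputable def mu (p n : ℕ) : Measure (X p n) := Measure.pi fun _ => _root_.stdGaussian p

instance prob_mu (p n : ℕ) : IsProbabilityMeasure (mu p n) := by unfold mu; infer_instance

lemma trace_gram {p n : ℕ} (Y : X p n) : (gram Y).trace = ∑ k, ‖Y k‖ ^ 2 := by
  simp only [gram, Matrix.trace_sum]
  refine Finset.sum_congr rfl fun k _ => ?_
  rw [EuclideanSpace.norm_sq_eq]
  simp [Matrix.trace, ← sq]

noncomputable def kap (p n : ℕ) : ℝ≥0∞ := ENNReal.ofReal (((2 * π) ^ (-(p : ℝ) / 2)) ^ n)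

lemma kap_ne_zero (p n : ℕ) : kap p n ≠ 0 := by
  unfold kap
  have : (0:ℝ) < ((2 * π) ^ (-(p : ℝ) / 2)) ^ n := by positivity
  simpa using this

lemma kap_ne_top (p n : ℕ) : kap p n ≠ ∞ := ENNReal.ofReal_ne_top

lemma prod_gd {p n : ℕ} (Y : X p n) : ∏ i, gd p (Y i) = kap p n * kk (gram Y) := by
  unfold gd kk kap
  rw [← ENNReal.ofReal_prod_of_nonneg (fun i _ => by positivity), Finset.prod_mul_distrib,
    ENNReal.ofReal_mul (by positivity), ← Real.exp_sum, trace_gram]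
  simp [neg_div, Finset.sum_div]

lemma lintegral_mu {p n : ℕ} {f : Matrix (Fin p) (Fin p) ℝ → ℝ≥0∞} (hf : Measurable f) :
    ∫⁻ Y, f (gram Y) ∂(mu p n) = kap p n * II p n (fun S => kk S * f S) := by
  have hS : (_root_.stdGaussian p) = volume.withDensity (gd p) := rfl
  have : SigmaFinite ((volume : Measure (EuclideanSpace ℝ (Fin p))).withDensity (gd p)) := by
    rw [← hS]; infer_instance
  have hmg : Measurable fun Y : X p n => kap p n * kk (gram Y) :=
    (measurable_kk.comp continuous_gram.measurable).const_mul _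
  have hmf : Measurable fun Y : X p n => f (gram Y) := hf.comp continuous_gram.measurable
  have hmk : Measurable fun Y : X p n => kk (gram Y) * f (gram Y) :=
    (measurable_kk.comp continuous_gram.measurable).mul hmf
  have h1 : mu p n = (volume : Measure (X p n)).withDensity fun Y => kap p n * kk (gram Y) := by
    unfold mu
    simp only [hS]
    rw [pi_withDensity _ _ (measurable_gd p)]
    simp only [prod_gd]
    rfl
  rw [h1, lintegral_withDensity_eq_lintegral_mul _ hmg hmf, II, ← lintegral_const_mul _ hmk]
  refine lintegral_congr fun Y => ?_
  simp [mul_assoc]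

lemma II_kk (p n : ℕ) : kap p n * II p n kk = 1 := by
  have := lintegral_mu (p := p) (n := n) (f := fun _ => 1) measurable_const
  simp at this
  exact this.symm

lemma C1_eq (p : ℕ) : C1 p = II p p kk := by
  unfold C1 II
  refine lintegral_congr fun G => ?_
  unfold kk
  rw [gram_eq, Matrix.trace_mul_comm]

lemma II_kk_ne_zero (p n : ℕ) : II p n kk ≠ 0 := by
  intro h
  have := II_kk p n
  simp [h] at this

lemma II_kk_ne_top (p n : ℕ) : II p n kk ≠ ∞ := by
  intro h
  have := II_kk p n
  rw [h, ENNReal.mul_top (kap_ne_zero p n)] at this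
  simp at this

lemma C2_ne {p n : ℕ} (hpn : p ≤ n) : C2 p n ≠ 0 ∧ C2 p n ≠ ∞ := by
  have h := main_id hpn (measurable_kk (p := p))
  have h0 : C1 p * II p n kk ≠ 0 :=
    mul_ne_zero (by rw [C1_eq]; exact II_kk_ne_zero p p) (II_kk_ne_zero p n)
  have ht : C1 p * II p n kk ≠ ∞ :=
    ENNReal.mul_ne_top (by rw [C1_eq]; exact II_kk_ne_top p p) (II_kk_ne_top p n)
  rw [h] at h0 ht
  refine ⟨right_ne_zero_of_mul h0, fun hc => ht ?_⟩
  rw [hc, ENNReal.mul_top (left_ne_zero_of_mul h0)]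

noncomputable def sd {p : ℕ} (S : Matrix (Fin p) (Fin p) ℝ) : ℝ≥0∞ := ENNReal.ofReal (√S.det)

lemma measurable_sd {p : ℕ} : Measurable (sd (p := p)) := by
  have h1 : Measurable fun S : Matrix (Fin p) (Fin p) ℝ => S.det :=
    continuous_id.matrix_det.measurable
  unfold sd
  exact h1.sqrt.ennreal_ofReal

lemma KK_succ {p m : ℕ} (hpm : p ≤ m) (g : Matrix (Fin p) (Fin p) ℝ → ℝ≥0∞) :
    KK p (m + 1) g = KK p m (fun S => sd S * g S) := by
  unfold KK
  refine lintegral_congr fun G => ?_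
  simp only [sd]
  rw [Matrix.det_mul, Matrix.det_transpose, Real.sqrt_mul_self_eq_abs, Nat.sub_add_comm hpm,
    pow_succ, ENNReal.ofReal_mul (by positivity), mul_assoc]

lemma density_step {p m : ℕ} (hpm : p ≤ m) : ∃ c : ℝ≥0∞,
    ∀ f : Matrix (Fin p) (Fin p) ℝ → ℝ≥0∞, Measurable f →
    ∫⁻ Y, f (gram Y) ∂(mu p (m + 1)) = c * ∫⁻ Y, sd (gram Y) * f (gram Y) ∂(mu p m) := by
  have hC10 : C1 p ≠ 0 := by rw [C1_eq]; exact II_kk_ne_zero p p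
  have hC1t : C1 p ≠ ∞ := by rw [C1_eq]; exact II_kk_ne_top p p
  obtain ⟨hC20, hC2t⟩ := C2_ne hpm
  refine ⟨kap p (m + 1) * (C2 p (m + 1) * (C2 p m)⁻¹) * (kap p m)⁻¹, fun f hf => ?_⟩
  have hkf : Measurable fun S => kk S * f S := measurable_kk.mul hf
  have hsf : Measurable fun S => sd S * f S := measurable_sd.mul hf
  have hskf : Measurable fun S => sd S * (kk S * f S) := measurable_sd.mul hkf
  rw [lintegral_mu hf, lintegral_mu hsf]
  have h1 := main_id (Nat.le_succ_of_le hpm) hkf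
  have h2 := main_id hpm hskf
  rw [Nat.succ_eq_add_one, KK_succ hpm] at h1
  have e : (fun S => kk S * (sd S * f S)) = fun S => sd S * (kk S * f S) := by
    ext S; ring
  rw [e]
  set I1 := II p (m + 1) fun S => kk S * f S
  set I2 := II p m fun S => sd S * (kk S * f S)
  set K := KK p m fun S => sd S * (kk S * f S)
  have h3 : K = C1 p * I2 * (C2 p m)⁻¹ := by
    rw [h2, mul_assoc, ENNReal.mul_inv_cancel hC20 hC2t, mul_one]
  have h4 : I1 = (C2 p (m + 1) * (C2 p m)⁻¹) * I2 := by
    rw [← ENNReal.mul_right_inj hC10 hC1t, h1, h3]; ring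
  rw [h4]
  calc _ = kap p (m + 1) * (C2 p (m + 1) * (C2 p m)⁻¹) * ((kap p m)⁻¹ * kap p m) * I2 := by
        rw [ENNReal.inv_mul_cancel (kap_ne_zero p m) (kap_ne_top p m)]; ring
    _ = _ := by ring

lemma gram_remove {p m : ℕ} (Y : X p (m + 1)) (k : Fin (m + 1)) :
    gram (fun j => Y (k.succAbove j)) =
      gram Y + Matrix.replicateCol Unit (-(Y k).ofLp) * Matrix.replicateRow Unit (Y k).ofLp := by
  have h : gram Y = (Matrix.of fun i j => Y k i * Y k j) + gram (fun j => Y (k.succAbove j)) := by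
    unfold gram
    rw [Fin.sum_univ_succAbove _ k]
  rw [h]
  ext i j
  simp [Matrix.mul_apply]

lemma sum_det_remove {p m : ℕ} (Y : X p (m + 1)) (hY : (gram Y).det ≠ 0) :
    ∑ k, (gram (fun j => Y ((k : Fin (m + 1)).succAbove j))).det =
      ((m : ℝ) + 1 - p) * (gram Y).det := by
  have hu : IsUnit (gram Y).det := isUnit_iff_ne_zero.mpr hY
  have h1 : ∀ k, (gram (fun j => Y ((k : Fin (m + 1)).succAbove j))).det =
      (gram Y).det * (1 - (mat Y * (gram Y)⁻¹ * (mat Y)ᵀ) k k) := by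
    intro k
    rw [gram_remove, Matrix.det_add_replicateCol_mul_replicateRow hu]
    congr 1
    rw [Matrix.det_unique, sub_eq_add_neg]
    simp [Matrix.mul_apply, mat]
  simp only [h1]
  rw [← Finset.mul_sum, Finset.sum_sub_distrib]
  have h2 : ∑ k, (mat Y * (gram Y)⁻¹ * (mat Y)ᵀ) k k = p := by
    change Matrix.trace _ = _
    rw [Matrix.trace_mul_comm, ← Matrix.mul_assoc, ← gram_eq, Matrix.mul_nonsing_inv _ hu]
    simp
  rw [h2]
  simp
  ring

lemma mp_remove (p m : ℕ) (k : Fin (m + 1)) :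
    MeasurePreserving (fun (Y : X p (m + 1)) (j : Fin m) => Y (k.succAbove j))
      (mu p (m + 1)) (mu p m) := by
  have h := measurePreserving_piFinSuccAbove (fun _ : Fin (m + 1) => _root_.stdGaussian p) k
  exact (measurePreserving_snd (μ := _root_.stdGaussian p) (ν := mu p m)).comp h

lemma mu_ac (p n : ℕ) : mu p n ≪ (volume : Measure (X p n)) := by
  have hS : (_root_.stdGaussian p) = volume.withDensity (gd p) := rfl
  have : SigmaFinite ((volume : Measure (EuclideanSpace ℝ (Fin p))).withDensity (gd p)) := by
    rw [← hS]; infer_instance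
  unfold mu
  simp only [hS]
  rw [pi_withDensity _ _ (measurable_gd p)]
  exact withDensity_absolutelyContinuous _ _

lemma leave_one_out {p m : ℕ} (hpm : p ≤ m + 1) :
    ENNReal.ofReal ((m : ℝ) + 1 - p) * ∫⁻ Y, ENNReal.ofReal (gram Y).det ∂(mu p (m + 1)) =
      ((m + 1 : ℕ) : ℝ≥0∞) * ∫⁻ Y, ENNReal.ofReal (gram Y).det ∂(mu p m) := by
  have hd : ∀ n, Measurable fun Y : X p n => ENNReal.ofReal (gram Y).det := fun n =>
    (continuous_gram.matrix_det.measurable).ennreal_ofReal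
  have hge : (0:ℝ) ≤ (m : ℝ) + 1 - p := by
    have : (p : ℝ) ≤ ((m + 1 : ℕ) : ℝ) := by exact_mod_cast hpm
    push_cast at this; linarith
  rw [← lintegral_const_mul _ (hd _)]
  have h1 : ∫⁻ Y, ENNReal.ofReal ((m : ℝ) + 1 - p) * ENNReal.ofReal (gram Y).det ∂(mu p (m + 1)) =
      ∫⁻ Y, ∑ k : Fin (m + 1), ENNReal.ofReal (gram (fun j => Y (k.succAbove j))).det
        ∂(mu p (m + 1)) := by
    refine lintegral_congr_ae ?_
    filter_upwards [(mu_ac p (m + 1)).ae_le (ae_det_gram_ne hpm)] with Y hY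
    rw [← ENNReal.ofReal_mul hge, ← sum_det_remove Y hY,
      ENNReal.ofReal_sum_of_nonneg fun k _ => (gram_posSemidef _).det_nonneg]
  rw [h1, lintegral_finsetSum]
  · have h2 : ∀ k : Fin (m + 1), ∫⁻ Y, ENNReal.ofReal (gram (fun j => Y (k.succAbove j))).det
        ∂(mu p (m + 1)) = ∫⁻ Y, ENNReal.ofReal (gram Y).det ∂(mu p m) := fun k =>
      (mp_remove p m k).lintegral_comp (hd m)
    simp [h2]
  · intro k _
    exact (hd m).comp (mp_remove p m k).measurable

lemma sd_sq {p n : ℕ} (Y : X p n) : sd (gram Y) * sd (gram Y) = ENNReal.ofReal (gram Y).det := by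
  unfold sd
  rw [← ENNReal.ofReal_mul (by positivity), Real.mul_self_sqrt (gram_posSemidef Y).det_nonneg]

/-- the abstract probabilistic estimate -/
lemma abstract_bound {Ω : Type*} [MeasurableSpace Ω] (μ : Measure Ω) [IsProbabilityMeasure μ]
    (D : Ω → ℝ) (hD0 : ∀ x, 0 ≤ D x) (hDm : Measurable D)
    (h2 : Integrable (fun x => D x ^ 2) μ) (h3 : Integrable (fun x => D x ^ 3) μ)
    (r : ℝ) (hr : r ≤ 1 + 1 / 100) (ha : 0 < ∫ x, D x ∂μ) (hr0 : 0 ≤ r)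
    (hrel : ∫ x, D x ^ 3 ∂μ ≤ r * ((∫ x, D x ∂μ) * ∫ x, D x ^ 2 ∂μ))
    (B : Set Ω) (hB : MeasurableSet B) :
    |(∫ x, D x ∂μ)⁻¹ * ∫ x in B, D x ∂μ - μ.real B| ≤ 0.1 := by
  have h1 : Integrable D μ := by
    by_contra hn
    rw [integral_undef hn] at ha
    exact lt_irrefl _ ha
  set a := ∫ x, D x ∂μ with haD
  set b := ∫ x, D x ^ 2 ∂μ with hbD
  set c := ∫ x, D x ^ 3 ∂μ with hcD
  have hb0 : 0 ≤ b := integral_nonneg fun x => by positivity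
  have hcs : b ^ 2 ≤ a * c := by
    have hIntg : ∫ x, D x * (a * D x - b) ^ 2 ∂μ = a ^ 2 * c - 2 * a * b * b + b ^ 2 * a := by
      have e : ∀ x, D x * (a * D x - b) ^ 2 =
        (a ^ 2 * D x ^ 3 - (2 * a * b) * D x ^ 2) + b ^ 2 * D x := fun x => by ring
      simp only [e]
      have i32 : Integrable (fun x => a ^ 2 * D x ^ 3 - (2 * a * b) * D x ^ 2) μ :=
        (h3.const_mul _).sub (h2.const_mul _)
      rw [integral_add i32 (h1.const_mul _),
        integral_sub (h3.const_mul _) (h2.const_mul _)]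
      simp only [integral_const_mul]
      rfl
    have hnn : 0 ≤ ∫ x, D x * (a * D x - b) ^ 2 ∂μ :=
      integral_nonneg fun x => mul_nonneg (hD0 x) (sq_nonneg _)
    rw [hIntg] at hnn
    have : 0 ≤ a * (a * c - b ^ 2) := by nlinarith
    have := nonneg_of_mul_nonneg_right this ha
    linarith
  have hba : b ≤ r * a ^ 2 := by
    rcases hb0.eq_or_lt with h | h
    · rw [← h]; positivity
    · have : b * b ≤ (r * a ^ 2) * b := by nlinarith
      exact le_of_mul_le_mul_right this h
  have hb' : (a⁻¹) ^ 2 * b ≤ 1 + 1 / 100 := by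
    have : (a⁻¹) ^ 2 * b ≤ (a⁻¹) ^ 2 * (r * a ^ 2) := by gcongr
    have e : (a⁻¹) ^ 2 * (r * a ^ 2) = r := by field_simp
    linarith
  have hsub : a⁻¹ * ∫ x in B, D x ∂μ - μ.real B = ∫ x in B, (a⁻¹ * D x - 1) ∂μ := by
    rw [integral_sub (h1.integrableOn.const_mul _) (integrable_const _), integral_const_mul]
    simp
  have hi1 : Integrable (fun x => a⁻¹ * D x - 1) μ := (h1.const_mul _).sub (integrable_const _)
  have hq : ∫ x, (5 * ((a⁻¹) ^ 2 * D x ^ 2 - 2 * a⁻¹ * D x + 1) + 0.05) ∂μ =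
      5 * ((a⁻¹) ^ 2 * b - 2 * a⁻¹ * a + 1) + 0.05 := by
    have i1 : Integrable (fun x => (a⁻¹) ^ 2 * D x ^ 2 - 2 * a⁻¹ * D x) μ :=
      (h2.const_mul _).sub (h1.const_mul _)
    have i2 : Integrable (fun x => 5 * ((a⁻¹) ^ 2 * D x ^ 2 - 2 * a⁻¹ * D x + 1)) μ :=
      (i1.add (integrable_const _)).const_mul _
    rw [integral_add i2 (integrable_const _),
      integral_const_mul, integral_add i1 (integrable_const _),
      integral_sub (h2.const_mul _) (h1.const_mul _), integral_const_mul, integral_const_mul]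
    simp [haD, hbD]
  have hiq : Integrable (fun x => (5 * ((a⁻¹) ^ 2 * D x ^ 2 - 2 * a⁻¹ * D x + 1) + 0.05)) μ :=
    ((((h2.const_mul _).sub (h1.const_mul _)).add (integrable_const _)).const_mul _).add
      (integrable_const _)
  rw [hsub]
  calc |∫ x in B, (a⁻¹ * D x - 1) ∂μ| ≤ ∫ x in B, |a⁻¹ * D x - 1| ∂μ := abs_integral_le_integral_abs
    _ ≤ ∫ x, |a⁻¹ * D x - 1| ∂μ :=
        setIntegral_le_integral hi1.abs (Filter.Eventually.of_forall fun x => abs_nonneg _)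
    _ ≤ ∫ x, (5 * ((a⁻¹) ^ 2 * D x ^ 2 - 2 * a⁻¹ * D x + 1) + 0.05) ∂μ := by
        refine integral_mono hi1.abs hiq fun x => ?_
        simp only
        set y := a⁻¹ * D x - 1
        have e : 5 * ((a⁻¹) ^ 2 * D x ^ 2 - 2 * a⁻¹ * D x + 1) + 0.05 = 5 * |y| ^ 2 + 0.05 := by
          rw [sq_abs]; simp only [y]; ring
        rw [e]
        nlinarith [sq_nonneg (|y| - 0.1)]
    _ ≤ 0.1 := by
        rw [hq, mul_assoc 2, inv_mul_cancel₀ ha.ne']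
        norm_num at hb' ⊢
        linarith

lemma tv_bound {p m : ℕ} (hpm : p ≤ m) (hsmall : 101 * (p : ℝ) ≤ (m : ℝ) + 1)
    (A : Set (Matrix (Fin p) (Fin p) ℝ)) (hA : MeasurableSet A) :
    |(wishart p (m + 1) A).toReal - (wishart p m A).toReal| ≤ 0.1 := by
  obtain ⟨c, hc⟩ := density_step hpm
  obtain ⟨c', hc'⟩ := density_step (Nat.le_succ_of_le hpm)
  have hw : ∀ n, wishart p n A = mu p n (gram ⁻¹' A) := fun n =>
    Measure.map_apply continuous_gram.measurable hA
  have hgm : ∀ n, Measurable (gram : X p n → _) := fun n => continuous_gram.measurable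
  set a := ∫⁻ Y, sd (gram Y) ∂(mu p m) with ha
  have hca : c * a = 1 := by
    have := hc (fun _ => 1) measurable_const
    simpa using this.symm
  have hca' : c' * ∫⁻ Y, sd (gram Y) ∂(mu p (m + 1)) = 1 := by
    have := hc' (fun _ => 1) measurable_const
    simpa using this.symm
  have hc0 : c ≠ 0 := by rintro rfl; simp at hca
  have hc0' : c' ≠ 0 := by rintro rfl; simp at hca'
  have ha0 : a ≠ 0 := by intro h; simp [h] at hca
  have hat : a ≠ ∞ := by intro h; rw [h, ENNReal.mul_top hc0] at hca; simp at hca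
  have hat' : ∫⁻ Y, sd (gram Y) ∂(mu p (m + 1)) ≠ ∞ := by
    intro h; rw [h, ENNReal.mul_top hc0'] at hca'; simp at hca'
  have hcinv : c = a⁻¹ := ENNReal.eq_inv_of_mul_eq_one_left hca
  set b := ∫⁻ Y, ENNReal.ofReal (gram Y).det ∂(mu p m) with hb
  have hb1 : ∫⁻ Y, sd (gram Y) ∂(mu p (m + 1)) = c * b := by
    rw [hc _ measurable_sd]
    simp only [sd_sq]
    rfl
  have hbt : b ≠ ∞ := by
    intro h
    rw [hb1, h, ENNReal.mul_top hc0] at hat'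
    exact hat' rfl
  set d := ∫⁻ Y, sd (gram Y) * ENNReal.ofReal (gram Y).det ∂(mu p m) with hd
  have hd1 : ∫⁻ Y, ENNReal.ofReal (gram Y).det ∂(mu p (m + 1)) = c * d :=
    hc (fun S => ENNReal.ofReal S.det) (continuous_id.matrix_det.measurable.ennreal_ofReal)
  have hl := leave_one_out (Nat.le_succ_of_le hpm)
  rw [hd1, ← hb] at hl
  have hnp : (0:ℝ) < (m : ℝ) + 1 - p := by
    have : (p : ℝ) ≤ m := by exact_mod_cast hpm
    linarith
  have hdt : d ≠ ∞ := by
    intro h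
    have h1 : ((m + 1 : ℕ) : ℝ≥0∞) * b ≠ ∞ := ENNReal.mul_ne_top (ENNReal.natCast_ne_top _) hbt
    rw [← hl, h, ENNReal.mul_top hc0, ENNReal.mul_top] at h1
    · exact h1 rfl
    · simpa using hnp
  let D : X p m → ℝ := fun Y => √((gram Y).det)
  have hDm : Measurable D := (continuous_gram.matrix_det.sqrt).measurable
  have hD0 : ∀ Y, 0 ≤ D Y := fun Y => Real.sqrt_nonneg _
  have hD2 : ∀ Y, D Y ^ 2 = (gram Y).det := fun Y => Real.sq_sqrt (gram_posSemidef Y).det_nonneg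
  have l2 : ∫⁻ Y, ENNReal.ofReal (D Y ^ 2) ∂(mu p m) = b := by simp only [hD2]; rfl
  have l3 : ∫⁻ Y, ENNReal.ofReal (D Y ^ 3) ∂(mu p m) = d := by
    rw [hd]
    refine lintegral_congr fun Y => ?_
    rw [pow_succ, hD2, mul_comm, ENNReal.ofReal_mul (hD0 Y)]
    rfl
  have l1 : ∫⁻ Y, ENNReal.ofReal (D Y) ∂(mu p m) = a := rfl
  have i1 : ∫ Y, D Y ∂(mu p m) = a.toReal := by
    rw [integral_eq_lintegral_of_nonneg_ae (Filter.Eventually.of_forall hD0)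
      hDm.aestronglyMeasurable, l1]
  have i2 : ∫ Y, D Y ^ 2 ∂(mu p m) = b.toReal := by
    rw [integral_eq_lintegral_of_nonneg_ae (Filter.Eventually.of_forall fun Y => by positivity)
      (hDm.pow_const 2).aestronglyMeasurable, l2]
  have i3 : ∫ Y, D Y ^ 3 ∂(mu p m) = d.toReal := by
    rw [integral_eq_lintegral_of_nonneg_ae
      (Filter.Eventually.of_forall fun Y => pow_nonneg (hD0 Y) 3)
      (hDm.pow_const 3).aestronglyMeasurable, l3]
  have n2 : Integrable (fun Y => D Y ^ 2) (mu p m) := by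
    refine (lintegral_ofReal_ne_top_iff_integrable (hDm.pow_const 2).aestronglyMeasurable
      (Filter.Eventually.of_forall fun Y => by positivity)).mp ?_
    rw [l2]; exact hbt
  have n3 : Integrable (fun Y => D Y ^ 3) (mu p m) := by
    refine (lintegral_ofReal_ne_top_iff_integrable (hDm.pow_const 3).aestronglyMeasurable
      (Filter.Eventually.of_forall fun Y => pow_nonneg (hD0 Y) 3)).mp ?_
    rw [l3]; exact hdt
  have hapos : 0 < a.toReal := ENNReal.toReal_pos ha0 hat
  have hrel : d.toReal ≤ (((m : ℝ) + 1) / ((m : ℝ) + 1 - p)) * (a.toReal * b.toReal) := by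
    have h := congrArg ENNReal.toReal hl
    rw [hcinv] at h
    simp only [ENNReal.toReal_mul, ENNReal.toReal_inv, ENNReal.toReal_ofReal hnp.le,
      ENNReal.toReal_natCast] at h
    push_cast at h
    have h5 : d.toReal = (((m : ℝ) + 1) / ((m : ℝ) + 1 - p)) * (a.toReal * b.toReal) := by
      field_simp at h ⊢
      linarith
    exact h5.le
  have hmain := abstract_bound (mu p m) D hD0 hDm n2 n3 (((m : ℝ) + 1) / ((m : ℝ) + 1 - p))
    (by rw [div_le_iff₀ hnp]; linarith) (by rw [i1]; exact hapos) (by positivity)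
    (by rw [i1, i2, i3]; exact hrel) (gram ⁻¹' A) (hgm m hA)
  have hWm : (wishart p m A).toReal = (mu p m).real (gram ⁻¹' A) := by rw [hw]; rfl
  have hWn : (wishart p (m + 1) A).toReal =
      (∫ Y, D Y ∂(mu p m))⁻¹ * ∫ Y in gram ⁻¹' A, D Y ∂(mu p m) := by
    have h := hc (A.indicator 1) (measurable_one.indicator hA)
    have e1 : ∫⁻ Y, A.indicator 1 (gram Y) ∂(mu p (m + 1)) = mu p (m + 1) (gram ⁻¹' A) := by
      rw [← lintegral_indicator_one (hgm _ hA)]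
      rfl
    have e2 : ∫⁻ Y, sd (gram Y) * A.indicator 1 (gram Y) ∂(mu p m) =
        ∫⁻ Y in gram ⁻¹' A, ENNReal.ofReal (D Y) ∂(mu p m) := by
      rw [← lintegral_indicator (hgm _ hA)]
      refine lintegral_congr fun Y => ?_
      by_cases hY : gram Y ∈ A
      · rw [Set.indicator_of_mem hY, Set.indicator_of_mem (show Y ∈ gram ⁻¹' A from hY)]
        simp [sd, D]
      · rw [Set.indicator_of_notMem hY, Set.indicator_of_notMem (show Y ∉ gram ⁻¹' A from hY)]
        simp
    rw [e1, e2] at h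
    rw [hw, h, ENNReal.toReal_mul, hcinv, ENNReal.toReal_inv, i1,
      integral_eq_lintegral_of_nonneg_ae (Filter.Eventually.of_forall hD0)
      hDm.aestronglyMeasurable]
  rw [hWm, hWn]
  exact hmain

end WishartAux

/-- for all sufficiently large `n`, with `p = ⌊0.00001(n-1)⌋`, the total
variation distance between `Wis(p, n)` and `Wis(p, n-1)` is at most `0.1`. -/
theorem wishart_tv_close :
    ∃ n₀ : ℕ, ∀ n : ℕ, n₀ ≤ n →
      ∀ A : Set (Matrix (Fin (Nat.floor (0.00001 * ((n : ℝ) - 1))))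
                        (Fin (Nat.floor (0.00001 * ((n : ℝ) - 1)))) ℝ),
        MeasurableSet A →
        |(wishart (Nat.floor (0.00001 * ((n : ℝ) - 1))) n A).toReal
          - (wishart (Nat.floor (0.00001 * ((n : ℝ) - 1))) (n - 1) A).toReal| ≤ 0.1 := by
  refine ⟨1, fun n hn A hA => ?_⟩
  obtain ⟨m, rfl⟩ : ∃ m, n = m + 1 := ⟨n - 1, by omega⟩
  have hfl : ((Nat.floor (0.00001 * (((m + 1 : ℕ) : ℝ) - 1)) : ℕ) : ℝ) ≤
      0.00001 * (((m + 1 : ℕ) : ℝ) - 1) := by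
    refine Nat.floor_le ?_
    push_cast
    have : (0:ℝ) ≤ m := Nat.cast_nonneg m
    simp only [add_sub_cancel_right]
    positivity
  have hm : (0:ℝ) ≤ m := Nat.cast_nonneg m
  have hfl2 : ((Nat.floor (0.00001 * (((m + 1 : ℕ) : ℝ) - 1)) : ℕ) : ℝ) ≤ 0.00001 * (m : ℝ) := by
    refine hfl.trans (le_of_eq ?_)
    push_cast
    ring
  refine WishartAux.tv_bound ?_ ?_ A hA
  · have : ((Nat.floor (0.00001 * (((m + 1 : ℕ) : ℝ) - 1)) : ℕ) : ℝ) ≤ (m : ℝ) :=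
      hfl2.trans (by linarith)
    exact_mod_cast this
  · norm_num at hfl2 ⊢; linarith
end

section
/- There exists n₀ ∈ ℕ such that for all n ≥ n₀, setting p = ⌊0.00001·(n−1)⌋ and μ = ∑_{j=1}^p log(n − p + j − 2), one has P_{W ∼ Wis(p,n−1)}[ |log det(W) − μ| > 0.038 ] ≤ 0.01. -/
open MeasureTheory ProbabilityTheory Real

namespace WishartAux

lemma stdG_eq (n : ℕ) : _root_.stdGaussian n = ProbabilityTheory.stdGaussian (EuclideanSpace ℝ (Fin n)) := by
  have hden : ∀ x : EuclideanSpace ℝ (Fin n), 0 ≤ (2 * π) ^ (-(n : ℝ) / 2) * Real.exp (-‖x‖ ^ 2 / 2) :=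
    fun x => by positivity
  have hcont : Continuous fun x : EuclideanSpace ℝ (Fin n) =>
    (2 * π) ^ (-(n : ℝ) / 2) * Real.exp (-‖x‖ ^ 2 / 2) := by fun_prop
  have hintegrable : Integrable (fun x : EuclideanSpace ℝ (Fin n) =>
      (2 * π) ^ (-(n : ℝ) / 2) * Real.exp (-‖x‖ ^ 2 / 2)) := by
    apply Integrable.const_mul
    have := GaussianFourier.integral_rexp_neg_mul_sq_norm (V := EuclideanSpace ℝ (Fin n)) (b := 1/2) (by norm_num)
    apply Integrable.of_integral_ne_zero
    have h2 : (fun x : EuclideanSpace ℝ (Fin n) => Real.exp (-‖x‖ ^ 2 / 2)) = fun x => Real.exp (-(1/2) * ‖x‖^2) := by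
      ext x; congr 1; ring
    rw [h2, this]
    positivity
  have : IsFiniteMeasure (_root_.stdGaussian n) := by
    unfold _root_.stdGaussian
    exact isFiniteMeasure_withDensity_ofReal hintegrable.2
  apply Measure.ext_of_charFun
  ext t
  rw [charFun_stdGaussian, charFun_apply]
  unfold _root_.stdGaussian
  rw [integral_withDensity_eq_integral_toReal_smul (by fun_prop) (by simp)]
  have key := GaussianFourier.integral_cexp_neg_mul_sq_norm_add (V := EuclideanSpace ℝ (Fin n)) (b := (1/2 : ℂ))
    (by norm_num) Complex.I t
  have h3 : ∀ x : EuclideanSpace ℝ (Fin n), 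
     (ENNReal.ofReal ((2 * π) ^ (-(n : ℝ) / 2) * Real.exp (-‖x‖ ^ 2 / 2))).toReal • Complex.exp ((inner ℝ x t : ℝ) * Complex.I)
     = (((2 * π) ^ (-(n : ℝ) / 2) : ℝ) : ℂ) * Complex.exp (-(1/2) * ‖x‖^2 + Complex.I * (inner ℝ t x : ℝ)) := by
    intro x
    rw [ENNReal.toReal_ofReal (hden x), Complex.real_smul, Complex.exp_add]
    push_cast
    rw [real_inner_comm]
    ring_nf
  simp_rw [h3]
  rw [integral_const_mul, key]
  have h4 : ((π : ℂ) / (1/2)) = ((2 * π : ℝ) : ℂ) := by push_cast; ring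
  rw [h4, finrank_euclideanSpace, Fintype.card_fin, ← mul_assoc]
  have h5 : (((n : ℂ)) / 2) = (((n : ℝ) / 2 : ℝ) : ℂ) := by push_cast; ring
  rw [h5, ← Complex.ofReal_cpow (by positivity), ← Complex.ofReal_mul, ← Real.rpow_add (by positivity)]
  simp
  ring_nf
  simp

/-- moment constant of chi-square with `k` degrees of freedom. -/
noncomputable def chiMom (k : ℕ) (s : ℝ) : ℝ :=
  2 ^ s * Real.Gamma ((k : ℝ) / 2 + s) / Real.Gamma ((k : ℝ) / 2)

lemma radial_integral (k : ℕ) (hk : 0 < k) (s : ℝ) (hs : 0 < (k : ℝ) / 2 + s) :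
    ∫ y in Set.Ioi (0 : ℝ), y ^ (k - 1) • ((y ^ 2) ^ s * Real.exp (-y ^ 2 / 2)) =
      2 ^ ((k : ℝ) / 2 + s) * (1 / 2) * Real.Gamma ((k : ℝ) / 2 + s) := by
  have h := integral_rpow_mul_exp_neg_mul_rpow (p := 2) (q := (k : ℝ) - 1 + 2 * s) (b := 1 / 2)
    (by norm_num) (by linarith) (by norm_num)
  have e1 : ((k : ℝ) - 1 + 2 * s + 1) / 2 = (k : ℝ) / 2 + s := by ring
  have e2 : -((k : ℝ) - 1 + 2 * s + 1) / 2 = -((k : ℝ) / 2 + s) := by ring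
  rw [e1, e2] at h
  rw [show (2 : ℝ) ^ ((k : ℝ) / 2 + s) = (1/2 : ℝ) ^ (-((k : ℝ) / 2 + s)) by
    rw [one_div, Real.inv_rpow (by norm_num), Real.rpow_neg (by norm_num), inv_inv], ← h]
  apply setIntegral_congr_fun measurableSet_Ioi
  intro y hy
  have hy : 0 < y := hy
  simp only [smul_eq_mul]
  rw [Real.rpow_add hy, Real.rpow_mul hy.le, ← mul_assoc]
  have : y ^ ((k : ℝ) - 1) = y ^ (k - 1) := by
    rw [← Real.rpow_natCast, Nat.cast_sub hk]; simp
  rw [this]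
  norm_num
  left
  ring

lemma lintegral_euclid (k : ℕ) (hk : 0 < k) (s : ℝ) (hs : 0 < (k : ℝ) / 2 + s) :
    ∫⁻ x, ENNReal.ofReal (‖x‖ ^ 2) ^ s ∂(ProbabilityTheory.stdGaussian (EuclideanSpace ℝ (Fin k)))
      = ENNReal.ofReal (chiMom k s) := by
  have : Nonempty (Fin k) := ⟨⟨0, hk⟩⟩
  set E := EuclideanSpace ℝ (Fin k) with hE
  have hd : Module.finrank ℝ E = k := by
    change Module.finrank ℝ (EuclideanSpace ℝ (Fin k)) = k
    rw [finrank_euclideanSpace, Fintype.card_fin]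
  set C : ℝ := (2 * π) ^ (-(k : ℝ) / 2) with hC
  have hCpos : 0 < C := by positivity
  have G : ∀ r : ℝ, 0 < (k : ℝ) / 2 + r → 
     0 < Real.Gamma ((k : ℝ) / 2 + r) := fun r hr => Real.Gamma_pos_of_pos hr
  obtain ⟨V, hV⟩ : ∃ V : ℝ, ∀ r : ℝ, 0 < (k : ℝ) / 2 + r →
    ∫ x : E, C * ((‖x‖ ^ 2) ^ r * Real.exp (-‖x‖ ^ 2 / 2)) = 
      V * (2 ^ ((k : ℝ) / 2 + r) * (1 / 2) * Real.Gamma ((k : ℝ) / 2 + r)) := by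
    refine ⟨C * (k * (volume : Measure E).real (Metric.ball 0 1)), fun r hr => ?_⟩
    have := integral_fun_norm_addHaar (E := E) volume (fun y => (y ^ 2) ^ r * Real.exp (-y ^ 2 / 2))
    rw [integral_const_mul, this]
    rw [hd]
    rw [radial_integral k hk r hr]
    simp
    ring
  have main : ∀ r : ℝ, 0 < (k : ℝ) / 2 + r →
      ∫⁻ x, ENNReal.ofReal (‖x‖ ^ 2) ^ r ∂(ProbabilityTheory.stdGaussian E) =
      ENNReal.ofReal (V * (2 ^ ((k : ℝ) / 2 + r) * (1 / 2) * Real.Gamma ((k : ℝ) / 2 + r))) := by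
    intro r hr
    have hintegrable : Integrable (fun x : E => C * ((‖x‖ ^ 2) ^ r * Real.exp (-‖x‖ ^ 2 / 2))) := by
      apply Integrable.const_mul
      rw [integrable_fun_norm_addHaar (E := E) volume (f := fun y => (y ^ 2) ^ r * Real.exp (-y ^ 2 / 2))]
      rw [hd]
      apply Integrable.of_integral_ne_zero
      rw [radial_integral k hk r hr]
      have := G r hr
      positivity
    rw [← hV r hr, ofReal_integral_eq_lintegral_ofReal hintegrable (Filter.Eventually.of_forall fun x => by positivity),
      ← stdG_eq]
    unfold _root_.stdGaussian
    rw [lintegral_withDensity_eq_lintegral_mul _ (by fun_prop) (by fun_prop)]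
    have hae : ∀ᵐ x : E ∂volume, x ≠ 0 := by
      simp [ae_iff]
    apply lintegral_congr_ae
    filter_upwards [hae] with x hx
    have hx : 0 < ‖x‖ := norm_pos_iff.2 hx
    rw [Pi.mul_apply, ENNReal.ofReal_rpow_of_pos (by positivity), ← ENNReal.ofReal_mul (by positivity)]
    congr 1
    ring
  have h0 := main 0 (by simpa using hk)
  simp only [ENNReal.rpow_zero, lintegral_one, measure_univ, add_zero] at h0
  have hG0 : 0 < Real.Gamma ((k : ℝ) / 2) := Real.Gamma_pos_of_pos (by positivity)
  have hV1 : V * (2 ^ ((k : ℝ) / 2) * (1 / 2) * Real.Gamma ((k : ℝ) / 2)) = 1 := by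
    exact (ENNReal.ofReal_eq_one.1 h0.symm)
  rw [main s hs]
  congr 1
  unfold chiMom
  rw [eq_div_iff hG0.ne', Real.rpow_add (by norm_num)]
  calc _ = (V * (2 ^ ((k : ℝ) / 2) * (1 / 2) * Real.Gamma ((k : ℝ) / 2))) * (2 ^ s * Real.Gamma ((k : ℝ) / 2 + s)) := by ring
    _ = _ := by rw [hV1, one_mul]

lemma map_proj {E : Type*} [NormedAddCommGroup E] [InnerProductSpace ℝ E] [FiniteDimensional ℝ E]
    [MeasurableSpace E] [BorelSpace E] (K : Submodule ℝ E) :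
    (ProbabilityTheory.stdGaussian E).map (K.orthogonalProjectionOnto) = ProbabilityTheory.stdGaussian K := by
  apply Measure.ext_of_charFun
  ext t
  rw [charFun_stdGaussian, charFun_apply, integral_map (by fun_prop) (by fun_prop)]
  have h := charFun_stdGaussian (t : E)
  rw [charFun_apply] at h
  rw [show ‖t‖ = ‖(t : E)‖ from rfl, ← h]
  congr 1
  ext x
  congr 3
  simp

lemma lintegral_proj {E : Type*} [NormedAddCommGroup E] [InnerProductSpace ℝ E] [FiniteDimensional ℝ E]
    [MeasurableSpace E] [BorelSpace E] (K : Submodule ℝ E) (k : ℕ) (hK : Module.finrank ℝ K = k)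
    (hk : 0 < k) (s : ℝ) (hs : 0 < (k : ℝ) / 2 + s) :
    ∫⁻ x, ENNReal.ofReal (‖K.orthogonalProjectionOnto x‖ ^ 2) ^ s ∂(ProbabilityTheory.stdGaussian E)
      = ENNReal.ofReal (chiMom k s) := by
  subst hK
  rw [← lintegral_map (f := fun y : K => ENNReal.ofReal (‖y‖ ^ 2) ^ s) (by fun_prop) (by fun_prop), map_proj,
    ← lintegral_euclid _ hk s hs, ← stdGaussian_map (stdOrthonormalBasis ℝ K).repr,
    lintegral_map (by fun_prop) (by fun_prop)]
  simp

open Matrix in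
lemma gram_lin {E : Type*} [NormedAddCommGroup E] [InnerProductSpace ℝ E] {n : ℕ}
    (M : Matrix (Fin n) (Fin n) ℝ) (y z : Fin n → E) (h : ∀ i, z i = ∑ k, M i k • y k) :
    Matrix.gram ℝ z = M * Matrix.gram ℝ y * Mᵀ := by
  ext i j
  simp only [Matrix.gram_apply, h, Matrix.mul_apply, sum_inner, inner_sum, inner_smul_left, inner_smul_right,
    Matrix.transpose_apply, Finset.sum_mul, Finset.mul_sum]
  refine Finset.sum_congr rfl fun a _ => Finset.sum_congr rfl fun b _ => ?_
  simp
  ring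

open Matrix in
lemma det_gram_cons {E : Type*} [NormedAddCommGroup E] [InnerProductSpace ℝ E] [FiniteDimensional ℝ E] {d : ℕ}
    (x : E) (v : Fin d → E) :
    (Matrix.gram ℝ (Fin.cons x v : Fin (d + 1) → E)).det =
      (Matrix.gram ℝ v).det * ‖(Submodule.span ℝ (Set.range v))ᗮ.orthogonalProjectionOnto x‖ ^ 2 := by
  set S := Submodule.span ℝ (Set.range v) with hS
  set w : E := ((Sᗮ.orthogonalProjectionOnto x : Sᗮ) : E) with hw
  have hwS : w ∈ Sᗮ := Submodule.coe_mem _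
  have hu : ((S.orthogonalProjectionOnto x : S) : E) ∈ S := Submodule.coe_mem _
  obtain ⟨c, hc⟩ := (Submodule.mem_span_range_iff_exists_fun ℝ).1 hu
  have hx : x = w + ∑ i, c i • v i := by
    rw [hc, add_comm, hw]
    exact (Submodule.starProjection_add_starProjection_orthogonal (K := S) x).symm
  let M : Matrix (Fin (d + 1)) (Fin (d + 1)) ℝ :=
    Matrix.of (Fin.cons (Fin.cons 1 c) (fun i => Fin.cons 0 (fun j => if i = j then 1 else 0)))
  have hM : M.det = 1 := by
    rw [Matrix.det_of_isUpperTriangular]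
    · rw [Fin.prod_univ_succ]
      simp [M]
    · intro i j hij
      simp only [id] at hij
      induction i using Fin.cases with
      | zero => simp at hij
      | succ i =>
        induction j using Fin.cases with
        | zero => simp [M]
        | succ j =>
          have : i ≠ j := by rintro rfl; exact lt_irrefl _ hij
          simp [M, this]
  have hz := gram_lin M (Fin.cons w v : Fin (d + 1) → E) (Fin.cons x v : Fin (d + 1) → E) (by
    intro i
    rw [Fin.sum_univ_succ]
    induction i using Fin.cases with
    | zero => simp [M, ← hx]
    | succ i => simp [M])
  rw [hz, Matrix.det_mul, Matrix.det_mul, Matrix.det_transpose, hM, one_mul, mul_one,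
    Matrix.det_succ_row_zero, Fin.sum_univ_succ]
  have h0 : ∀ i : Fin d, inner ℝ w (v i) = 0 := fun i =>
    Submodule.inner_left_of_mem_orthogonal (Submodule.subset_span (Set.mem_range_self i)) hwS
  have hsub : (Matrix.gram ℝ (Fin.cons w v : Fin (d + 1) → E)).submatrix Fin.succ (Fin.succAbove 0) = Matrix.gram ℝ v := by
    ext i j
    simp
  rw [hsub, show ‖Sᗮ.orthogonalProjectionOnto x‖ = ‖w‖ from rfl]
  simp [h0]
  rw [mul_comm]

lemma continuous_det_gram {E : Type*} [NormedAddCommGroup E] [InnerProductSpace ℝ E] (d : ℕ) :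
    Continuous fun v : Fin d → E => (Matrix.gram ℝ v).det := by
  apply Continuous.matrix_det
  unfold Matrix.gram
  fun_prop

lemma step_bound {m d : ℕ} (hdm : d < m) (s : ℝ) (hs0 : s ≠ 0) (hs : 0 < ((m - d : ℕ) : ℝ) / 2 + s)
    (v : Fin d → EuclideanSpace ℝ (Fin m)) :
    ∫⁻ x, ENNReal.ofReal ((Matrix.gram ℝ (Fin.cons x v : Fin (d + 1) → EuclideanSpace ℝ (Fin m))).det) ^ s
      ∂(ProbabilityTheory.stdGaussian (EuclideanSpace ℝ (Fin m))) ≤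
    ENNReal.ofReal (chiMom (m - d) s) * ENNReal.ofReal ((Matrix.gram ℝ v).det) ^ s := by
  simp_rw [det_gram_cons]
  have hmd : 0 < m - d := by omega
  have hD0 : 0 ≤ (Matrix.gram ℝ v).det := (Matrix.posSemidef_gram ℝ v).det_nonneg
  have hpos : 0 < chiMom (m - d) s := by
    unfold chiMom
    have h1 := Real.Gamma_pos_of_pos hs
    have h2 : 0 < Real.Gamma (((m - d : ℕ) : ℝ) / 2) := Real.Gamma_pos_of_pos (by positivity)
    positivity
  by_cases hD : (Matrix.gram ℝ v).det = 0
  · simp only [hD, zero_mul, ENNReal.ofReal_zero]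
    rcases lt_or_gt_of_ne hs0 with h | h
    · rw [ENNReal.zero_rpow_of_neg h, ENNReal.mul_top (by simpa using hpos)]
      exact le_top
    · simp [ENNReal.zero_rpow_of_pos h]
  · have hli := Matrix.det_gram_ne_zero_iff_linearIndependent.1 hD
    have hfr : Module.finrank ℝ (Submodule.span ℝ (Set.range v))ᗮ = m - d := by
      have h1 := finrank_span_eq_card hli
      have h2 := (Submodule.span ℝ (Set.range v)).finrank_add_finrank_orthogonal
      rw [h1, finrank_euclideanSpace, Fintype.card_fin, Fintype.card_fin] at h2
      omega
    simp_rw [ENNReal.ofReal_mul hD0]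
    simp_rw [ENNReal.mul_rpow_of_ne_top ENNReal.ofReal_ne_top ENNReal.ofReal_ne_top]
    rw [lintegral_const_mul _ (by fun_prop), lintegral_proj _ _ hfr hmd s hs, mul_comm]

lemma moment_bound {m : ℕ} (s : ℝ) (hs0 : s ≠ 0) (p : ℕ) (hpm : p ≤ m)
    (hs : ∀ d < p, 0 < ((m - d : ℕ) : ℝ) / 2 + s) :
    ∫⁻ v, ENNReal.ofReal ((Matrix.gram ℝ v).det) ^ s
      ∂(Measure.pi fun _ : Fin p => ProbabilityTheory.stdGaussian (EuclideanSpace ℝ (Fin m))) ≤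
    ∏ d ∈ Finset.range p, ENNReal.ofReal (chiMom (m - d) s) := by
  induction p with
  | zero => simp
  | succ p ih =>
    have mp := (measurePreserving_piFinSuccAbove
      (fun _ : Fin (p + 1) => ProbabilityTheory.stdGaussian (EuclideanSpace ℝ (Fin m))) 0).symm
    have hmeas : Measurable fun v : Fin (p + 1) → EuclideanSpace ℝ (Fin m) =>
        ENNReal.ofReal ((Matrix.gram ℝ v).det) ^ s :=
      ((continuous_det_gram _).measurable.ennreal_ofReal).pow_const s
    have hmeas2 := hmeas.comp mp.measurable
    simp only [Function.comp_def] at hmeas2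
    rw [← mp.lintegral_comp hmeas, lintegral_prod_symm _ hmeas2.aemeasurable,
      Finset.prod_range_succ, mul_comm]
    refine le_trans (lintegral_mono (g := fun v : Fin p → EuclideanSpace ℝ (Fin m) =>
      ENNReal.ofReal (chiMom (m - p) s) * ENNReal.ofReal ((Matrix.gram ℝ v).det) ^ s) fun v => ?_) ?_
    · refine le_trans (le_of_eq ?_) (step_bound (by omega) s hs0 (hs p (by omega)) v)
      refine lintegral_congr fun x => ?_
      simp [MeasurableEquiv.piFinSuccAbove, Fin.insertNthEquiv]
    · rw [lintegral_const_mul _ (((continuous_det_gram _).measurable.ennreal_ofReal).pow_const s)]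
      gcongr
      exact ih (by omega) fun d hd => hs d (by omega)

lemma transpose_law (p m : ℕ) :
    (Measure.pi fun _ : Fin m => _root_.stdGaussian p).map
      (fun g (i : Fin p) => WithLp.toLp 2 (fun k => g k i)) =
    Measure.pi fun _ : Fin p => ProbabilityTheory.stdGaussian (EuclideanSpace ℝ (Fin m)) := by
  have key : ∀ a b : ℕ, (Measure.pi fun _ : Fin a => ProbabilityTheory.stdGaussian (EuclideanSpace ℝ (Fin b))) =
      (Measure.infinitePi fun _ : Fin a × Fin b => gaussianReal 0 1).map
        (fun f i => WithLp.toLp 2 (fun k => f (i, k))) := by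
    intro a b
    have h1 := Measure.infinitePi_map_curry (fun (_ : Fin a) (_ : Fin b) => gaussianReal 0 1)
    simp_rw [Measure.infinitePi_eq_pi] at h1
    have h2 := Measure.pi_map_pi (ι := Fin a) (μ := fun _ => Measure.pi fun _ : Fin b => gaussianReal 0 1)
      (f := fun _ => WithLp.toLp 2) (fun _ => by fun_prop)
    rw [map_pi_eq_stdGaussian] at h2
    rw [← h2, ← h1, Measure.map_map (by fun_prop) (by fun_prop), Measure.infinitePi_eq_pi]
    rfl
  rw [key p m]
  simp_rw [stdG_eq]
  rw [key m p, Measure.map_map (by fun_prop) (by fun_prop)]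
  have h3 := Measure.infinitePi_map_piCongrLeft (X := fun _ => ℝ) (fun _ : Fin p × Fin m => gaussianReal 0 1) (Equiv.prodComm (Fin m) (Fin p))
  rw [← h3, Measure.map_map (by fun_prop) (by fun_prop)]
  congr 1

lemma chiMom_zero (k : ℕ) (hk : 0 < k) : chiMom k 0 = 1 := by
  unfold chiMom
  have h : 0 < Real.Gamma ((k : ℝ) / 2) := Real.Gamma_pos_of_pos (by positivity)
  rw [Real.rpow_zero, add_zero, one_mul, div_self h.ne']

lemma chiMom_succ (k : ℕ) (s : ℝ) (hs : (k : ℝ) / 2 + s ≠ 0) :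
    chiMom k (s + 1) = ((k : ℝ) + 2 * s) * chiMom k s := by
  unfold chiMom
  rw [← add_assoc, Real.Gamma_add_one hs, Real.rpow_add_one (by norm_num)]
  ring

lemma chiMom_nonneg (k : ℕ) (s : ℝ) (hs : 0 < (k : ℝ) / 2 + s) : 0 ≤ chiMom k s := by
  unfold chiMom
  have h1 := Real.Gamma_pos_of_pos hs
  have h2 : 0 ≤ Real.Gamma ((k : ℝ) / 2) := Real.Gamma_nonneg_of_nonneg (by positivity)
  positivity

lemma chiMom_pos_bound (k : ℕ) (hk : 2 ≤ k) (r : ℕ) :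
    chiMom k r ≤ Real.exp (r * Real.log ((k : ℝ) - 1) + (r : ℝ) ^ 2 / ((k : ℝ) - 1)) := by
  have hk' : (2 : ℝ) ≤ k := by exact_mod_cast hk
  have hk1 : (0 : ℝ) < (k : ℝ) - 1 := by linarith
  induction r with
  | zero => simp [chiMom_zero k (by omega)]
  | succ r ih =>
    push_cast
    rw [chiMom_succ k r (by positivity)]
    have h1 : (k : ℝ) + 2 * r ≤ Real.exp (Real.log ((k : ℝ) - 1) + (2 * r + 1) / ((k : ℝ) - 1)) := by
      rw [Real.exp_add, Real.exp_log hk1]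
      have := Real.add_one_le_exp ((2 * (r : ℝ) + 1) / ((k : ℝ) - 1))
      calc (k : ℝ) + 2 * r = ((k : ℝ) - 1) * ((2 * (r : ℝ) + 1) / ((k : ℝ) - 1) + 1) := by
            field_simp; ring
        _ ≤ _ := by gcongr
    calc _ ≤ Real.exp (Real.log ((k : ℝ) - 1) + (2 * r + 1) / ((k : ℝ) - 1)) *
          Real.exp (r * Real.log ((k : ℝ) - 1) + (r : ℝ) ^ 2 / ((k : ℝ) - 1)) := by
            have := chiMom_nonneg k r (by positivity)
            gcongr
      _ = _ := by
        rw [← Real.exp_add]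
        congr 1
        field_simp
        ring

lemma chiMom_neg_bound (k R : ℕ) (hR : 1 ≤ R) (hk : 2 * R < k) (r : ℕ) (hr : r ≤ R) :
    chiMom k (-(r : ℝ)) ≤ Real.exp (-(r : ℝ) * Real.log ((k : ℝ) - 1) + (r : ℝ) ^ 2 / ((k : ℝ) - 2 * R)) := by
  have hk' : (2 : ℝ) * R < k := by exact_mod_cast hk
  have hR' : (1 : ℝ) ≤ R := by exact_mod_cast hR
  have hk1 : (0 : ℝ) < (k : ℝ) - 1 := by linarith
  have hk2 : (0 : ℝ) < (k : ℝ) - 2 * R := by linarith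
  induction r with
  | zero => simp [chiMom_zero k (by omega)]
  | succ r ih =>
    have ih := ih (by omega)
    have hrR : (r : ℝ) + 1 ≤ R := by exact_mod_cast hr
    have hq : (0 : ℝ) < (k : ℝ) + 2 * (-((r : ℝ) + 1)) := by linarith
    have h := chiMom_succ k (-((r : ℝ) + 1)) (by linarith)
    rw [show -((r : ℝ) + 1) + 1 = -(r : ℝ) by ring] at h
    push_cast
    have h1 : 1 ≤ ((k : ℝ) + 2 * (-((r : ℝ) + 1))) *
        Real.exp (-Real.log ((k : ℝ) - 1) + (2 * r + 1) / ((k : ℝ) - 2 * R)) := by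
      rw [Real.exp_add, Real.exp_neg, Real.exp_log hk1]
      have h2 := Real.add_one_le_exp ((2 * (r : ℝ) + 1) / ((k : ℝ) - 2 * R))
      have h3 : (2 * (r : ℝ) + 1) / ((k : ℝ) + 2 * (-((r : ℝ) + 1))) ≤ (2 * (r : ℝ) + 1) / ((k : ℝ) - 2 * R) := by
        apply div_le_div_of_nonneg_left (by positivity) hk2; linarith
      calc (1 : ℝ) = ((k : ℝ) + 2 * (-((r : ℝ) + 1))) * (((k : ℝ) - 1)⁻¹ * 
            ((2 * (r : ℝ) + 1) / ((k : ℝ) + 2 * (-((r : ℝ) + 1))) + 1)) := by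
            generalize hQ : (k : ℝ) + 2 * (-((r : ℝ) + 1)) = Q at hq
            have hk3 : (k : ℝ) - 1 = Q + (2 * r + 1) := by linarith
            rw [hk3] at hk1 ⊢
            field_simp
            ring
        _ ≤ _ := by
          gcongr
          linarith
    have hnn := chiMom_nonneg k (-((r : ℝ) + 1)) (by linarith)
    calc chiMom k (-((r : ℝ) + 1)) = chiMom k (-((r : ℝ) + 1)) * 1 := by ring
      _ ≤ chiMom k (-((r : ℝ) + 1)) * (((k : ℝ) + 2 * (-((r : ℝ) + 1))) *
        Real.exp (-Real.log ((k : ℝ) - 1) + (2 * r + 1) / ((k : ℝ) - 2 * R))) := by gcongr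
      _ = chiMom k (-(r : ℝ)) * Real.exp (-Real.log ((k : ℝ) - 1) + (2 * r + 1) / ((k : ℝ) - 2 * R)) := by
        rw [h]; ring
      _ ≤ Real.exp (-(r : ℝ) * Real.log ((k : ℝ) - 1) + (r : ℝ) ^ 2 / ((k : ℝ) - 2 * R)) * 
          Real.exp (-Real.log ((k : ℝ) - 1) + (2 * r + 1) / ((k : ℝ) - 2 * R)) := by gcongr
      _ = _ := by
        rw [← Real.exp_add]
        congr 1
        field_simp
        ring

/-- Both exponents at once, for `s = 200` and `s = -200`. -/
lemma chiMom_bound (k : ℕ) (hk : 400 < k) (s : ℝ) (hs : s = 200 ∨ s = -200) :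
    chiMom k s ≤ Real.exp (s * Real.log ((k : ℝ) - 1) + 40000 / ((k : ℝ) - 400)) := by
  have hk' : (400 : ℝ) < k := by exact_mod_cast hk
  rcases hs with rfl | rfl
  · have := chiMom_pos_bound k (by omega) 200
    push_cast at this
    refine this.trans (Real.exp_le_exp.2 ?_)
    have h2 : (200 : ℝ) ^ 2 / ((k : ℝ) - 1) ≤ 40000 / ((k : ℝ) - 400) := by
      norm_num
      apply div_le_div_of_nonneg_left (by norm_num) <;> linarith
    linarith
  · have := chiMom_neg_bound k 200 (by omega) (by omega) 200 le_rfl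
    push_cast at this
    refine this.trans (Real.exp_le_exp.2 ?_)
    norm_num

lemma tail (m p : ℕ) (hm : 1000000 ≤ m) (hp : (p : ℝ) ≤ 0.00001 * m) (s : ℝ) (hs : s = 200 ∨ s = -200)
    (M : ℝ) (hM : M = ∑ d ∈ Finset.range p, Real.log (((m - d : ℕ) : ℝ) - 1)) :
    (Measure.pi fun _ : Fin p => ProbabilityTheory.stdGaussian (EuclideanSpace ℝ (Fin m)))
      {v | ENNReal.ofReal (Real.exp (s * M + 7.6)) ≤ ENNReal.ofReal ((Matrix.gram ℝ v).det) ^ s} ≤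
    ENNReal.ofReal 0.005 := by
  have hm' : (1000000 : ℝ) ≤ m := by exact_mod_cast hm
  have hpm : p ≤ m := by
    have : (p : ℝ) ≤ m := by linarith
    exact_mod_cast this
  have hcast : ∀ d < p, ((m - d : ℕ) : ℝ) = (m : ℝ) - d := fun d hd => Nat.cast_sub (by omega)
  have hlow : ∀ d < p, 0.999 * (m : ℝ) ≤ ((m - d : ℕ) : ℝ) - 400 := by
    intro d hd
    rw [hcast d hd]
    have : (d : ℝ) < p := by exact_mod_cast hd
    linarith
  have hs0 : s ≠ 0 := by rcases hs with rfl | rfl <;> norm_num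
  have hs1 : -200 ≤ s := by rcases hs with rfl | rfl <;> norm_num
  have hpos : ∀ d < p, 0 < ((m - d : ℕ) : ℝ) / 2 + s := by
    intro d hd
    have := hlow d hd
    linarith
  have hmom := moment_bound s hs0 p hpm hpos
  have hprod : ∏ d ∈ Finset.range p, chiMom (m - d) s ≤ Real.exp (s * M + 0.401) := by
    calc _ ≤ ∏ d ∈ Finset.range p, Real.exp (s * Real.log (((m - d : ℕ) : ℝ) - 1) + 40000 / (0.999 * m)) := by
          apply Finset.prod_le_prod
          · intro d hd
            exact chiMom_nonneg _ _ (hpos d (Finset.mem_range.1 hd))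
          · intro d hd
            have h1 := hlow d (Finset.mem_range.1 hd)
            have h2 : 400 < m - d := by
              have : (400 : ℝ) < ((m - d : ℕ) : ℝ) := by linarith
              exact_mod_cast this
            refine (chiMom_bound _ h2 s hs).trans (Real.exp_le_exp.2 ?_)
            gcongr
      _ = Real.exp (s * M + p * (40000 / (0.999 * m))) := by
          rw [← Real.exp_sum, Finset.sum_add_distrib, ← Finset.mul_sum, ← hM]
          simp
      _ ≤ _ := by
          apply Real.exp_le_exp.2
          have : p * (40000 / (0.999 * (m : ℝ))) ≤ 0.401 := by
            rw [← mul_div_assoc, div_le_iff₀ (by positivity)]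
            linarith
          linarith
  refine (meas_ge_le_lintegral_div
    (((continuous_det_gram _).measurable.ennreal_ofReal).pow_const s).aemeasurable
    (by simpa using Real.exp_pos _) ENNReal.ofReal_ne_top).trans ?_
  rw [← ENNReal.ofReal_prod_of_nonneg (fun d hd => chiMom_nonneg _ _ (hpos d (Finset.mem_range.1 hd)))] at hmom
  calc _ ≤ ENNReal.ofReal (Real.exp (s * M + 0.401)) / ENNReal.ofReal (Real.exp (s * M + 7.6)) := by
        gcongr
        exact hmom.trans (ENNReal.ofReal_le_ofReal hprod)
    _ = ENNReal.ofReal (Real.exp (s * M + 0.401) / Real.exp (s * M + 7.6)) := by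
        rw [ENNReal.ofReal_div_of_pos (Real.exp_pos _)]
    _ ≤ _ := by
        apply ENNReal.ofReal_le_ofReal
        rw [← Real.exp_sub, show s * M + 0.401 - (s * M + 7.6) = -7.199 by ring]
        have h1 : Real.exp (-7.199) ≤ Real.exp (-7) := Real.exp_le_exp.2 (by norm_num)
        have h2 : Real.exp (-7) = (Real.exp 1 ^ 7)⁻¹ := by
          rw [← Real.exp_nat_mul, ← Real.exp_neg]; norm_num
        have h3 : (2.7 : ℝ) ^ 7 ≤ Real.exp 1 ^ 7 := by
          have := Real.exp_one_gt_d9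
          gcongr
          linarith
        rw [h2] at h1
        refine h1.trans ?_
        rw [inv_le_comm₀ (by positivity) (by norm_num)]
        refine le_trans ?_ h3
        norm_num

lemma measurable_matrix_det (p : ℕ) : Measurable fun W : Matrix (Fin p) (Fin p) ℝ => W.det := by
  simp only [Matrix.det_apply']
  refine Finset.measurable_sum _ fun σ _ => ?_
  refine Measurable.const_mul ?_ _
  refine Finset.measurable_prod _ fun i _ => ?_
  exact (measurable_pi_apply i).comp (measurable_pi_apply (σ i))

lemma wishart_eq (p m : ℕ) (S : Set (Matrix (Fin p) (Fin p) ℝ)) (hS : MeasurableSet S) :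
    wishart p m S = (Measure.pi fun _ : Fin p => ProbabilityTheory.stdGaussian (EuclideanSpace ℝ (Fin m)))
      {v | Matrix.gram ℝ v ∈ S} := by
  have hgram : Measurable fun v : Fin p → EuclideanSpace ℝ (Fin m) => Matrix.gram ℝ v := by
    refine measurable_pi_lambda _ fun i => measurable_pi_lambda _ fun j => ?_
    simp only [Matrix.gram_apply]
    fun_prop
  have hT : Measurable fun (g : Fin m → EuclideanSpace ℝ (Fin p)) (i : Fin p) =>
      (WithLp.toLp 2 (fun k => g k i) : EuclideanSpace ℝ (Fin m)) := by fun_prop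
  have hfun : (fun g : Fin m → EuclideanSpace ℝ (Fin p) => ∑ k, Matrix.of fun i j => g k i * g k j) =
      (fun v : Fin p → EuclideanSpace ℝ (Fin m) => Matrix.gram ℝ v) ∘
        (fun (g : Fin m → EuclideanSpace ℝ (Fin p)) (i : Fin p) =>
        (WithLp.toLp 2 (fun k => g k i) : EuclideanSpace ℝ (Fin m))) := by
    ext g i j
    simp [Matrix.sum_apply, PiLp.inner_apply, mul_comm]
  unfold wishart
  rw [hfun, ← Measure.map_map hgram hT, transpose_law, Measure.map_apply hgram hS]
  rfl

end WishartAux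

open WishartAux in
/-- for all sufficiently large `n`, with `p = ⌊0.00001(n-1)⌋` and
`μ = ∑_{j=1}^p log(n - p + j - 2)`, the log-determinant of a `Wis(p, n-1)` matrix deviates
from `μ` by more than `0.038` with probability at most `0.01`. -/
theorem wishart_log_det_concentration :
    ∃ n₀ : ℕ, ∀ n : ℕ, n₀ ≤ n →
      wishart (Nat.floor (0.00001 * ((n : ℝ) - 1))) (n - 1)
        {W | |Real.log W.det
          - ∑ j ∈ Finset.Icc 1 (Nat.floor (0.00001 * ((n : ℝ) - 1))),
              Real.log ((n : ℝ) - (Nat.floor (0.00001 * ((n : ℝ) - 1)) : ℝ) + (j : ℝ) - 2)|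
            > 0.038} ≤ 1 / 100 := by
  refine ⟨1000001, fun n hn => ?_⟩
  have hn' : (1000001 : ℝ) ≤ n := by exact_mod_cast hn
  have hp0 : ((Nat.floor (0.00001 * ((n : ℝ) - 1)) : ℕ) : ℝ) ≤ 0.00001 * ((n : ℝ) - 1) :=
    Nat.floor_le (by nlinarith)
  generalize Nat.floor (0.00001 * ((n : ℝ) - 1)) = p at hp0 ⊢
  obtain ⟨m, rfl⟩ : ∃ m, n = m + 1 := ⟨n - 1, by omega⟩
  have hm : 1000000 ≤ m := by omega
  have hm' : (1000000 : ℝ) ≤ m := by exact_mod_cast hm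
  have hp : (p : ℝ) ≤ 0.00001 * m := by push_cast at hp0; linarith
  have hpm : p ≤ m := by
    have : (p : ℝ) ≤ m := by linarith
    exact_mod_cast this
  rw [Nat.add_sub_cancel]
  have hsum : ∑ j ∈ Finset.Icc 1 p, Real.log (((m + 1 : ℕ) : ℝ) - (p : ℝ) + (j : ℝ) - 2) =
      ∑ d ∈ Finset.range p, Real.log (((m - d : ℕ) : ℝ) - 1) := by
    refine Finset.sum_nbij' (fun j => p - j) (fun d => p - d) ?_ ?_ ?_ ?_ ?_
    · intro j hj; simp only [Finset.mem_Icc, Finset.mem_range] at *; omega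
    · intro j hj; simp only [Finset.mem_Icc, Finset.mem_range] at *; omega
    · intro j hj; simp only [Finset.mem_Icc] at *; omega
    · intro j hj; simp only [Finset.mem_range] at *; omega
    · intro j hj
      simp only [Finset.mem_Icc] at hj
      congr 1
      rw [Nat.cast_sub (by omega), Nat.cast_sub hj.2]
      push_cast
      ring
  rw [hsum]
  obtain ⟨M, hM⟩ : ∃ M, M = ∑ d ∈ Finset.range p, Real.log (((m - d : ℕ) : ℝ) - 1) := ⟨_, rfl⟩
  rw [← hM]
  have hM0 : 0 ≤ M := by
    rw [hM]
    refine Finset.sum_nonneg fun d hd => Real.log_nonneg ?_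
    have hd := Finset.mem_range.1 hd
    have : (d : ℝ) < p := by exact_mod_cast hd
    rw [Nat.cast_sub (by omega)]
    linarith
  have hmeas : MeasurableSet {W : Matrix (Fin p) (Fin p) ℝ | |Real.log W.det - M| > 0.038} :=
    measurableSet_lt measurable_const
      (((measurable_matrix_det p).log.sub_const M).abs)
  rw [wishart_eq p m _ hmeas]
  have h1 := tail m p hm hp 200 (Or.inl rfl) M hM
  have h2 := tail m p hm hp (-200) (Or.inr rfl) M hM
  refine (measure_mono (t := 
    {v | ENNReal.ofReal (Real.exp (200 * M + 7.6)) ≤ ENNReal.ofReal ((Matrix.gram ℝ v).det) ^ (200 : ℝ)} ∪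
    {v | ENNReal.ofReal (Real.exp (-200 * M + 7.6)) ≤ ENNReal.ofReal ((Matrix.gram ℝ v).det) ^ (-200 : ℝ)})
    ?_).trans ((measure_union_le _ _).trans ((add_le_add h1 h2).trans ?_))
  · intro v hv
    have hD0 : 0 ≤ (Matrix.gram ℝ v).det := (Matrix.posSemidef_gram ℝ v).det_nonneg
    simp only [Set.mem_ofPred_eq, Set.mem_union] at hv ⊢
    rcases hD0.eq_or_lt with hD | hD
    · right
      rw [← hD, ENNReal.ofReal_zero, ENNReal.zero_rpow_of_neg (by norm_num)]
      exact le_top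
    · rw [ENNReal.ofReal_rpow_of_pos hD, ENNReal.ofReal_rpow_of_pos hD, Real.rpow_def_of_pos hD,
        Real.rpow_def_of_pos hD]
      rcases lt_abs.1 hv with h | h
      · left
        apply ENNReal.ofReal_le_ofReal
        apply Real.exp_le_exp.2
        linarith
      · right
        apply ENNReal.ofReal_le_ofReal
        apply Real.exp_le_exp.2
        linarith
  · rw [← ENNReal.ofReal_add (by norm_num) (by norm_num)]
    rw [show (1 / 100 : ENNReal) = ENNReal.ofReal (1 / 100) by
      rw [ENNReal.ofReal_div_of_pos (by norm_num)]; simp]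
    apply ENNReal.ofReal_le_ofReal
    norm_num
end
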